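/- arXiv:2601.23144 — 7 statements merged into one kernel-verified Lean document; each statement's English description precedes it below -/
import Mathlib

section
/- For every odd prime p, there exists a finite solvable group G (admitting a 2-covering, i.e. with d(G) ≥ 3) such that σ₂(G) = 1 + p² + p³ + p⁴. -/
/-- A 2-covering of a group `G`: a finite set of proper subgroups of `G` such that
every pair of elements of `G` is contained in at least one subgroup in the set. -/
def IsTwoCovering {G : Type*} [Group G] (𝒞 : Finset (Subgroup G)) : Prop :=
  (∀ H ∈ 𝒞, H ≠ ⊤) ∧ ∀ x y : G, ∃ H ∈ 𝒞, x ∈ H ∧ y ∈ H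

/-- The 2-covering number `σ₂(G)`: the smallest cardinality of a 2-covering of `G`. -/
noncomputable def sigma2 (G : Type*) [Group G] : ℕ :=
  sInf {n : ℕ | ∃ 𝒞 : Finset (Subgroup G), IsTwoCovering 𝒞 ∧ 𝒞.card = n}

open Matrix
open scoped LinearAlgebra.Projectivization

/-- The semidirect product of the additive group of `2 × 3` matrices with `H`, where `H` acts
on matrices by left multiplication through the representation `ρ`. -/
@[ext]
structure MatrixExtension {F H : Type*} [Field F] [Group H]
    (ρ : H →* Matrix (Fin 2) (Fin 2) F) where
  /-- The translation part. -/
  trans : Matrix (Fin 2) (Fin 3) F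
  /-- The linear part. -/
  lin : H

namespace MatrixExtension

section Group

variable {F H : Type*} [Field F] [Group H] {ρ : H →* Matrix (Fin 2) (Fin 2) F}

instance : Mul (MatrixExtension ρ) := ⟨fun x y => ⟨x.trans + ρ x.lin * y.trans, x.lin * y.lin⟩⟩

instance : One (MatrixExtension ρ) := ⟨⟨0, 1⟩⟩

instance : Inv (MatrixExtension ρ) := ⟨fun x => ⟨-(ρ x.lin⁻¹ * x.trans), x.lin⁻¹⟩⟩

@[simp] lemma mul_trans (x y : MatrixExtension ρ) :
    (x * y).trans = x.trans + ρ x.lin * y.trans := rfl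

@[simp] lemma mul_lin (x y : MatrixExtension ρ) : (x * y).lin = x.lin * y.lin := rfl

@[simp] lemma one_trans : (1 : MatrixExtension ρ).trans = 0 := rfl

@[simp] lemma one_lin : (1 : MatrixExtension ρ).lin = 1 := rfl

@[simp] lemma inv_trans (x : MatrixExtension ρ) : x⁻¹.trans = -(ρ x.lin⁻¹ * x.trans) := rfl

@[simp] lemma inv_lin (x : MatrixExtension ρ) : x⁻¹.lin = x.lin⁻¹ := rfl

instance : Group (MatrixExtension ρ) :=
  Group.ofLeftAxioms
    (fun x y z => by ext1 <;> simp [Matrix.mul_add, Matrix.mul_assoc, add_assoc, mul_assoc])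
    (fun x => by ext1 <;> simp)
    (fun x => by ext1 <;> simp)

instance [Finite F] [Finite H] : Finite (MatrixExtension ρ) :=
  Finite.of_injective (fun x => (x.trans, x.lin)) fun x y h => by
    ext1
    · exact congrArg Prod.fst h
    · exact congrArg Prod.snd h

/-- The projection onto the linear part. -/
def linHom (ρ : H →* Matrix (Fin 2) (Fin 2) F) : MatrixExtension ρ →* H where
  toFun := lin
  map_one' := rfl
  map_mul' _ _ := rfl

@[simp] lemma linHom_apply (x : MatrixExtension ρ) : linHom ρ x = x.lin := rfl

/-- The inclusion of the translations. -/
def transHom (ρ : H →* Matrix (Fin 2) (Fin 2) F) :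
    Multiplicative (Matrix (Fin 2) (Fin 3) F) →* MatrixExtension ρ where
  toFun A := ⟨A.toAdd, 1⟩
  map_one' := rfl
  map_mul' A B := by ext1 <;> simp

instance isSolvable [Group.IsSolvable H] : Group.IsSolvable (MatrixExtension ρ) :=
  Group.isSolvable_of_ker_le_range (transHom ρ) (linHom ρ) fun x hx =>
    ⟨Multiplicative.ofAdd x.trans, by
      have hx' : x.lin = 1 := hx
      ext1
      · rfl
      · exact hx'.symm⟩

/-- The stabilizer of the point `v` in the affine action attached to the column vector `c`. -/
def pointStabilizer (ρ : H →* Matrix (Fin 2) (Fin 2) F) (c : Fin 3 → F) (v : Fin 2 → F) :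
    Subgroup (MatrixExtension ρ) where
  carrier := {x | x.trans *ᵥ c + ρ x.lin *ᵥ v = v}
  one_mem' := by
    simp only [Set.mem_ofPred_eq, one_trans, one_lin, map_one, zero_mulVec, one_mulVec, zero_add]
  mul_mem' {x y} hx hy := by
    simp only [Set.mem_ofPred_eq] at hx hy ⊢
    calc (x * y).trans *ᵥ c + ρ (x * y).lin *ᵥ v
        = x.trans *ᵥ c + ρ x.lin *ᵥ (y.trans *ᵥ c + ρ y.lin *ᵥ v) := by
          simp only [mul_trans, mul_lin, map_mul, add_mulVec, mulVec_add, mulVec_mulVec, add_assoc]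
      _ = v := by rw [hy, hx]
  inv_mem' {x} hx := by
    simp only [Set.mem_ofPred_eq] at hx ⊢
    have hinv : ρ x.lin⁻¹ * ρ x.lin = 1 := by rw [← map_mul, inv_mul_cancel, map_one]
    have h : ρ x.lin⁻¹ *ᵥ (x.trans *ᵥ c + ρ x.lin *ᵥ v) = ρ x.lin⁻¹ *ᵥ v := by rw [hx]
    rw [mulVec_add, mulVec_mulVec, mulVec_mulVec, hinv, one_mulVec] at h
    rw [inv_trans, inv_lin, neg_mulVec, ← h]
    abel

lemma mem_pointStabilizer {c : Fin 3 → F} {v : Fin 2 → F} {x : MatrixExtension ρ} :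
    x ∈ pointStabilizer ρ c v ↔ x.trans *ᵥ c + ρ x.lin *ᵥ v = v := Iff.rfl

lemma mk_one_mem_pointStabilizer {c : Fin 3 → F} {v : Fin 2 → F}
    {A : Matrix (Fin 2) (Fin 3) F} :
    (⟨A, 1⟩ : MatrixExtension ρ) ∈ pointStabilizer ρ c v ↔ A *ᵥ c = 0 := by
  simp [mem_pointStabilizer]

lemma pointStabilizer_smul {c : Fin 3 → F} {v : Fin 2 → F} {a : F} (ha : a ≠ 0) :
    pointStabilizer ρ (a • c) (a • v) = pointStabilizer ρ c v := by
  ext x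
  rw [mem_pointStabilizer, mem_pointStabilizer, mulVec_smul, mulVec_smul, ← smul_add]
  exact (smul_right_injective _ ha).eq_iff

/-- The translations contained in a subgroup. -/
def translations (K : Subgroup (MatrixExtension ρ)) :
    AddSubgroup (Matrix (Fin 2) (Fin 3) F) where
  carrier := {A | (⟨A, 1⟩ : MatrixExtension ρ) ∈ K}
  zero_mem' := K.one_mem
  add_mem' {A B} hA hB := by
    have h : (⟨A, 1⟩ * ⟨B, 1⟩ : MatrixExtension ρ) = ⟨A + B, 1⟩ := by ext1 <;> simp
    rw [Set.mem_ofPred_eq, ← h]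
    exact K.mul_mem hA hB
  neg_mem' {A} hA := by
    have h : (⟨A, 1⟩⁻¹ : MatrixExtension ρ) = ⟨-A, 1⟩ := by ext1 <;> simp
    rw [Set.mem_ofPred_eq, ← h]
    exact K.inv_mem hA

lemma mem_translations {K : Subgroup (MatrixExtension ρ)} {A : Matrix (Fin 2) (Fin 3) F} :
    A ∈ translations K ↔ (⟨A, 1⟩ : MatrixExtension ρ) ∈ K := Iff.rfl

lemma rho_mul_mem_translations {K : Subgroup (MatrixExtension ρ)} (hK : K.map (linHom ρ) = ⊤)
    (h : H) {A : Matrix (Fin 2) (Fin 3) F} (hA : A ∈ translations K) :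
    ρ h * A ∈ translations K := by
  obtain ⟨x, hx, rfl⟩ : h ∈ K.map (linHom ρ) := hK ▸ Subgroup.mem_top h
  have hconj : x * ⟨A, 1⟩ * x⁻¹ = ⟨ρ x.lin * A, 1⟩ := by
    ext1
    · simp [← Matrix.mul_assoc, ← map_mul, ← Matrix.mul_neg]
    · simp
  rw [mem_translations, linHom_apply, ← hconj]
  exact K.mul_mem (K.mul_mem hx hA) (K.inv_mem hx)

/-- A subgroup that surjects onto the linear parts contains every element of any larger subgroup
whose translations it contains. -/
lemma le_of_translations_le {K L : Subgroup (MatrixExtension ρ)} (hK : K.map (linHom ρ) = ⊤)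
    (hKL : K ≤ L) (hT : translations L ≤ translations K) : L ≤ K := by
  intro x hx
  obtain ⟨y, hy, hyx⟩ : x.lin ∈ K.map (linHom ρ) := hK ▸ Subgroup.mem_top _
  rw [linHom_apply] at hyx
  have hdiff : x * y⁻¹ = ⟨(x * y⁻¹).trans, 1⟩ := by ext1 <;> simp [hyx]
  have hmem : (x * y⁻¹).trans ∈ translations L := by
    rw [mem_translations, ← hdiff]
    exact L.mul_mem hx (L.inv_mem (hKL hy))
  have hK' := mem_translations.1 (hT hmem)
  rw [← hdiff] at hK'
  simpa using K.mul_mem hK' hy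

/-- The subspace of matrices killing a nonzero vector `c` consists of the multiples of a single
matrix `E`. -/
lemma exists_annihilator_factorization {c : Fin 3 → F} (hc : c ≠ 0) :
    ∃ (E : Matrix (Fin 2) (Fin 3) F) (R : Matrix (Fin 3) (Fin 2) F) (r : Fin 3 → F),
      r ⬝ᵥ c = 1 ∧ E *ᵥ c = 0 ∧ R * E + vecMulVec c r = 1 := by
  obtain ⟨k, hk⟩ := Function.ne_iff.1 hc
  have hk' : c k ≠ 0 := hk
  fin_cases k
  · refine ⟨!![-c 1 / c 0, 1, 0; -c 2 / c 0, 0, 1], !![0, 0; 1, 0; 0, 1], ![(c 0)⁻¹, 0, 0],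
      ?_, ?_, ?_⟩
    · simp_all [dotProduct, Fin.sum_univ_three]
    · ext i; fin_cases i <;> simp_all [mulVec, dotProduct, Fin.sum_univ_three]
    · ext i j; fin_cases i <;> fin_cases j <;> simp_all <;> field_simp <;> ring
  · refine ⟨!![1, -c 0 / c 1, 0; 0, -c 2 / c 1, 1], !![1, 0; 0, 0; 0, 1], ![0, (c 1)⁻¹, 0],
      ?_, ?_, ?_⟩
    · simp_all [dotProduct, Fin.sum_univ_three]
    · ext i; fin_cases i <;> simp_all [mulVec, dotProduct, Fin.sum_univ_three]
    · ext i j; fin_cases i <;> fin_cases j <;> simp_all <;> field_simp <;> ring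
  · refine ⟨!![1, 0, -c 0 / c 2; 0, 1, -c 1 / c 2], !![1, 0; 0, 1; 0, 0], ![0, 0, (c 2)⁻¹],
      ?_, ?_, ?_⟩
    · simp_all [dotProduct, Fin.sum_univ_three]
    · ext i; fin_cases i <;> simp_all [mulVec, dotProduct, Fin.sum_univ_three]
    · ext i j; fin_cases i <;> fin_cases j <;> simp_all <;> field_simp <;> ring

lemma exists_mem_pointStabilizer {c : Fin 3 → F} (hc : c ≠ 0) (v : Fin 2 → F) (h : H) :
    ∃ A, (⟨A, h⟩ : MatrixExtension ρ) ∈ pointStabilizer ρ c v := by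
  obtain ⟨-, -, r, hr, -, -⟩ := exists_annihilator_factorization hc
  refine ⟨vecMulVec (v - ρ h *ᵥ v) r, ?_⟩
  rw [mem_pointStabilizer, vecMulVec_mulVec, hr, MulOpposite.op_one, one_smul, sub_add_cancel]

end Group


section Prime

variable {p : ℕ} [Fact p.Prime] {H : Type*} [Group H]
  {ρ : H →* Matrix (Fin 2) (Fin 2) (ZMod p)} {i j : H}

/-- The properties of the two-dimensional representation of the quaternion group that determine
the `2`-covering number of the extension: it is fixed point free and absolutely irreducible, and
the group is generated by two elements with the same square. -/
structure IsQuaternionic (ρ : H →* Matrix (Fin 2) (Fin 2) (ZMod p)) (i j : H) : Prop where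
  eq_zero_of_fixed : ∀ h : H, h ≠ 1 → ∀ w : Fin 2 → ZMod p, ρ h *ᵥ w = w → w = 0
  span_range : Submodule.span (ZMod p) (Set.range ρ) = ⊤
  mul_self_eq : i * i = j * j
  isUnit_one_add : IsUnit (1 + ρ i)
  eq_top_of_mem : ∀ S : Subgroup H, i ∈ S → j ∈ S → S = ⊤

lemma mul_mem_translations (hspan : Submodule.span (ZMod p) (Set.range ρ) = ⊤)
    {K : Subgroup (MatrixExtension ρ)} (hK : K.map (linHom ρ) = ⊤)
    (X : Matrix (Fin 2) (Fin 2) (ZMod p)) {A : Matrix (Fin 2) (Fin 3) (ZMod p)}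
    (hA : A ∈ translations K) : X * A ∈ translations K := by
  have hX : X ∈ Submodule.span (ZMod p) (Set.range ρ) := hspan ▸ Submodule.mem_top
  induction hX using Submodule.span_induction with
  | mem _ h =>
    obtain ⟨h, rfl⟩ := h
    exact rho_mul_mem_translations hK h hA
  | zero => simp
  | add _ _ _ _ hx hy =>
    rw [Matrix.add_mul]
    exact add_mem hx hy
  | smul a _ _ hx =>
    rw [Matrix.smul_mul]
    exact ((AddSubgroup.toZModSubmodule p) (translations K)).smul_mem a hx

/-- Point stabilizers are generated by two elements. -/
lemma exists_pair_generating_pointStabilizer (hρ : IsQuaternionic ρ i j) {c : Fin 3 → ZMod p}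
    (hc : c ≠ 0) (v : Fin 2 → ZMod p) :
    ∃ x y : MatrixExtension ρ, ∀ K : Subgroup (MatrixExtension ρ), x ∈ K → y ∈ K →
      pointStabilizer ρ c v ≤ K := by
  obtain ⟨E, R, r, hr, hE, hRE⟩ := exists_annihilator_factorization hc
  set V := vecMulVec v r
  have hVc : V *ᵥ c = v := by rw [vecMulVec_mulVec, hr, MulOpposite.op_one, one_smul]
  let x : MatrixExtension ρ := ⟨E + (V - ρ i * V), i⟩
  let y : MatrixExtension ρ := ⟨V - ρ j * V, j⟩
  have hx : x ∈ pointStabilizer ρ c v := by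
    rw [mem_pointStabilizer, add_mulVec, sub_mulVec, ← mulVec_mulVec, hVc, hE]
    rw [zero_add, sub_add_cancel]
  have hy : y ∈ pointStabilizer ρ c v := by
    rw [mem_pointStabilizer, sub_mulVec, ← mulVec_mulVec, hVc]
    rw [sub_add_cancel]
  have hsq : ρ i * ρ i = ρ j * ρ j := by rw [← map_mul, ← map_mul, hρ.mul_self_eq]
  have hxy : x * x = ⟨(1 + ρ i) * E, 1⟩ * (y * y) := by
    ext1
    · have h1 : ρ i * (ρ i * V) = ρ j * (ρ j * V) := by
        rw [← Matrix.mul_assoc, hsq, Matrix.mul_assoc]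
      simp only [x, y, mul_trans, map_one, Matrix.one_mul, Matrix.add_mul, Matrix.mul_add,
        Matrix.mul_sub, h1]
      abel
    · simp [x, y, hρ.mul_self_eq]
  refine ⟨x, y, fun K hxK hyK => ?_⟩
  have hsurj : ∀ L : Subgroup (MatrixExtension ρ), x ∈ L → y ∈ L → L.map (linHom ρ) = ⊤ :=
    fun L hxL hyL => hρ.eq_top_of_mem _ ⟨x, hxL, rfl⟩ ⟨y, hyL, rfl⟩
  have hET : E ∈ translations K := by
    have h1 : (1 + ρ i) * E ∈ translations K := by
      rw [mem_translations, ← mul_inv_eq_of_eq_mul hxy]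
      exact K.mul_mem (K.mul_mem hxK hxK) (K.inv_mem (K.mul_mem hyK hyK))
    obtain ⟨X, hX⟩ := hρ.isUnit_one_add.exists_left_inv
    have h2 := mul_mem_translations hρ.span_range (hsurj K hxK hyK) X h1
    rwa [← Matrix.mul_assoc, hX, Matrix.one_mul] at h2
  refine le_trans (le_of_translations_le (K := K ⊓ pointStabilizer ρ c v)
    (hsurj _ ⟨hxK, hx⟩ ⟨hyK, hy⟩) inf_le_right fun B hB => ?_) inf_le_left
  refine ⟨?_, hB⟩
  have hBc : B *ᵥ c = 0 := mk_one_mem_pointStabilizer.1 hB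
  have hfac : B = B * R * E := by
    conv_lhs => rw [← Matrix.mul_one B, ← hRE, Matrix.mul_add, mul_vecMulVec, hBc,
      ← Matrix.mul_assoc]
    simp
  have := mul_mem_translations hρ.span_range (hsurj K hxK hyK) (B * R) hET
  rwa [← hfac] at this

lemma map_linHom_pointStabilizer {c : Fin 3 → ZMod p} (hc : c ≠ 0) (v : Fin 2 → ZMod p) :
    (pointStabilizer ρ c v).map (linHom ρ) = ⊤ :=
  eq_top_iff.2 fun h _ =>
    let ⟨A, hA⟩ := exists_mem_pointStabilizer hc v h
    ⟨⟨A, h⟩, hA, rfl⟩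

/-- Point stabilizers are maximal subgroups. -/
lemma eq_pointStabilizer_of_le (hspan : Submodule.span (ZMod p) (Set.range ρ) = ⊤)
    {c : Fin 3 → ZMod p} (hc : c ≠ 0) {v : Fin 2 → ZMod p} {K : Subgroup (MatrixExtension ρ)}
    (hle : pointStabilizer ρ c v ≤ K) (hK : K ≠ ⊤) : K = pointStabilizer ρ c v := by
  have hsurj : K.map (linHom ρ) = ⊤ :=
    eq_top_iff.2 ((map_linHom_pointStabilizer hc v).symm.le.trans (Subgroup.map_mono hle))
  refine le_antisymm (le_of_translations_le (map_linHom_pointStabilizer hc v) hle ?_) hle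
  intro B hB
  rw [mem_translations, mk_one_mem_pointStabilizer]
  by_contra hBc
  refine hK (eq_top_iff.2 (le_of_translations_le hsurj le_top fun C _ => ?_))
  obtain ⟨k, hk⟩ := Function.ne_iff.1 hBc
  have hk' : (B *ᵥ c) k ≠ 0 := hk
  let X := vecMulVec (C *ᵥ c) (Pi.single k ((B *ᵥ c) k)⁻¹)
  have hX : X *ᵥ (B *ᵥ c) = C *ᵥ c := by
    rw [vecMulVec_mulVec, single_dotProduct, inv_mul_cancel₀ hk', MulOpposite.op_one, one_smul]
  have hdiff : C - X * B ∈ translations K :=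
    hle (mk_one_mem_pointStabilizer.2 (by rw [sub_mulVec, ← mulVec_mulVec, hX, sub_self]))
  have := add_mem hdiff (mul_mem_translations hspan hsurj X hB)
  rwa [sub_add_cancel] at this

/-- Two translations that do not lie in a common point stabilizer. -/
lemma exists_pair_translations_not_mem (ρ : H →* Matrix (Fin 2) (Fin 2) (ZMod p)) :
    ∃ x y : MatrixExtension ρ, x.lin = 1 ∧ y.lin = 1 ∧
      ∀ c ≠ 0, ∀ v, ¬ (x ∈ pointStabilizer ρ c v ∧ y ∈ pointStabilizer ρ c v) := by
  refine ⟨⟨!![1, 0, 0; 0, 1, 0], 1⟩, ⟨!![0, 0, 1; 0, 0, 0], 1⟩, rfl, rfl, ?_⟩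
  rintro c hc v ⟨hx, hy⟩
  rw [mk_one_mem_pointStabilizer] at hx hy
  refine hc (funext fun k => ?_)
  have h0 := congrFun hx 0
  have h1 := congrFun hx 1
  have h2 := congrFun hy 0
  simp [mulVec, dotProduct, Fin.sum_univ_three] at h0 h1 h2
  fin_cases k <;> assumption

lemma exists_pointStabilizer_mem (hρ : IsQuaternionic ρ i j) {x y : MatrixExtension ρ}
    (hxy : x.lin ≠ 1 ∨ y.lin ≠ 1) :
    ∃ c ≠ 0, ∃ v, x ∈ pointStabilizer ρ c v ∧ y ∈ pointStabilizer ρ c v := by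
  let f (z : MatrixExtension ρ) :
      ((Fin 3 → ZMod p) × (Fin 2 → ZMod p)) →ₗ[ZMod p] (Fin 2 → ZMod p) :=
    z.trans.mulVecLin.coprod ((ρ z.lin).mulVecLin - LinearMap.id)
  have hf : ∀ z c v, f z (c, v) = 0 ↔ z ∈ pointStabilizer ρ c v := fun z c v => by
    rw [mem_pointStabilizer, ← sub_eq_zero (b := v), add_sub_assoc]
    rfl
  have hker : LinearMap.ker ((f x).prod (f y)) ≠ ⊥ :=
    LinearMap.ker_ne_bot_of_finrank_lt (by simp)
  obtain ⟨⟨c, v⟩, hcv, hne⟩ := Submodule.exists_mem_ne_zero_of_ne_bot hker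
  have hcv' : f x (c, v) = 0 ∧ f y (c, v) = 0 := by simpa using hcv
  rw [hf, hf] at hcv'
  refine ⟨c, ?_, v, hcv'⟩
  rintro rfl
  refine hne (Prod.ext rfl ?_)
  obtain ⟨hx, hy⟩ := hcv'
  rw [mem_pointStabilizer, mulVec_zero, zero_add] at hx hy
  rcases hxy with h | h
  · exact hρ.eq_zero_of_fixed _ h v hx
  · exact hρ.eq_zero_of_fixed _ h v hy

/-- The point stabilizers, indexed by a point of the projective plane and a vector. -/
noncomputable def projectiveStabilizer (ρ : H →* Matrix (Fin 2) (Fin 2) (ZMod p))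
    (q : ℙ (ZMod p) (Fin 3 → ZMod p) × (Fin 2 → ZMod p)) : Subgroup (MatrixExtension ρ) :=
  pointStabilizer ρ q.1.rep q.2

lemma pointStabilizer_mem_range {c : Fin 3 → ZMod p} (hc : c ≠ 0) (v : Fin 2 → ZMod p) :
    pointStabilizer ρ c v ∈ Set.range (projectiveStabilizer ρ) := by
  obtain ⟨a, ha⟩ := Projectivization.exists_smul_eq_mk_rep (ZMod p) c hc
  refine ⟨(.mk (ZMod p) c hc, (a : ZMod p) • v), ?_⟩
  rw [projectiveStabilizer, ← ha]
  exact pointStabilizer_smul a.ne_zero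

lemma projectiveStabilizer_injective [Nontrivial H] (hρ : IsQuaternionic ρ i j) :
    Function.Injective (projectiveStabilizer ρ) := by
  rintro ⟨P, v⟩ ⟨Q, w⟩ h
  have h' : pointStabilizer ρ P.rep v = pointStabilizer ρ Q.rep w := h
  have hPQ : P = Q := by
    obtain ⟨E, R, r, -, hE, hRE⟩ := exists_annihilator_factorization P.rep_nonzero
    have hEQ : E *ᵥ Q.rep = 0 := by
      rw [← mk_one_mem_pointStabilizer (ρ := ρ) (v := w), ← h', mk_one_mem_pointStabilizer, hE]
    have hQ : (r ⬝ᵥ Q.rep) • P.rep = Q.rep := by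
      conv_rhs => rw [← one_mulVec Q.rep, ← hRE, add_mulVec, ← mulVec_mulVec, hEQ, mulVec_zero,
        zero_add, vecMulVec_mulVec, op_smul_eq_smul]
    rw [← P.mk_rep, ← Q.mk_rep, eq_comm, Projectivization.mk_eq_mk_iff']
    exact ⟨_, hQ⟩
  subst hPQ
  obtain ⟨h, hne⟩ := exists_ne (1 : H)
  obtain ⟨A, hA⟩ := exists_mem_pointStabilizer (ρ := ρ) P.rep_nonzero v h
  have hA' := h' ▸ hA
  rw [mem_pointStabilizer] at hA hA'
  refine Prod.ext rfl (sub_eq_zero.1 (hρ.eq_zero_of_fixed h hne _ ?_))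
  rw [mulVec_sub, ← add_sub_add_left_eq_sub _ _ (A *ᵥ P.rep), hA, hA']

lemma card_projective_prod :
    Nat.card (ℙ (ZMod p) (Fin 3 → ZMod p) × (Fin 2 → ZMod p)) = p ^ 2 + p ^ 3 + p ^ 4 := by
  rw [Nat.card_prod, Projectivization.card_of_finrank (n := 3) _ _ (by simp)]
  simp [Finset.sum_range_succ]
  ring

lemma exists_isTwoCovering [Nontrivial H] (hρ : IsQuaternionic ρ i j) :
    ∃ 𝒞 : Finset (Subgroup (MatrixExtension ρ)), IsTwoCovering 𝒞 ∧
      𝒞.card = 1 + p ^ 2 + p ^ 3 + p ^ 4 := by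
  classical
  have := Fintype.ofFinite (ℙ (ZMod p) (Fin 3 → ZMod p) × (Fin 2 → ZMod p))
  obtain ⟨x₀, y₀, hx₀, hy₀, h₀⟩ := exists_pair_translations_not_mem ρ
  have hker : (linHom ρ).ker ∉ Finset.univ.image (projectiveStabilizer ρ) := by
    rw [Finset.mem_image]
    rintro ⟨⟨P, v⟩, -, h⟩
    exact h₀ P.rep P.rep_nonzero v ⟨h.ge hx₀, h.ge hy₀⟩
  refine ⟨insert (linHom ρ).ker (Finset.univ.image (projectiveStabilizer ρ)), ⟨?_, ?_⟩, ?_⟩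
  · intro K hK
    rw [Finset.mem_insert, Finset.mem_image] at hK
    rcases hK with rfl | ⟨⟨P, v⟩, -, rfl⟩
    · obtain ⟨h, hne⟩ := exists_ne (1 : H)
      intro htop
      exact hne (htop.ge (Subgroup.mem_top (⟨0, h⟩ : MatrixExtension ρ)))
    · intro htop
      exact h₀ P.rep P.rep_nonzero v ⟨htop.ge (Subgroup.mem_top _), htop.ge (Subgroup.mem_top _)⟩
  · intro x y
    by_cases hxy : x.lin = 1 ∧ y.lin = 1
    · exact ⟨_, Finset.mem_insert_self _ _, hxy.1, hxy.2⟩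
    · obtain ⟨c, hc, v, hmem⟩ := exists_pointStabilizer_mem hρ (not_and_or.1 hxy)
      obtain ⟨q, hq⟩ := pointStabilizer_mem_range (ρ := ρ) hc v
      exact ⟨_, Finset.mem_insert_of_mem (Finset.mem_image.2 ⟨q, Finset.mem_univ _, hq⟩), hmem⟩
  · rw [Finset.card_insert_of_notMem hker,
      Finset.card_image_of_injective _ (projectiveStabilizer_injective hρ), Finset.card_univ,
      ← Nat.card_eq_fintype_card, card_projective_prod]
    ring

lemma le_card_of_isTwoCovering [Nontrivial H] (hρ : IsQuaternionic ρ i j)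
    {𝒞 : Finset (Subgroup (MatrixExtension ρ))} (h𝒞 : IsTwoCovering 𝒞) :
    1 + p ^ 2 + p ^ 3 + p ^ 4 ≤ 𝒞.card := by
  classical
  have := Fintype.ofFinite (ℙ (ZMod p) (Fin 3 → ZMod p) × (Fin 2 → ZMod p))
  obtain ⟨x₀, y₀, -, -, h₀⟩ := exists_pair_translations_not_mem ρ
  obtain ⟨K₀, hK₀, hmem₀⟩ := h𝒞.2 x₀ y₀
  have hnot : K₀ ∉ Finset.univ.image (projectiveStabilizer ρ) := by
    rw [Finset.mem_image]
    rintro ⟨⟨P, v⟩, -, rfl⟩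
    exact h₀ P.rep P.rep_nonzero v hmem₀
  have hsub : insert K₀ (Finset.univ.image (projectiveStabilizer ρ)) ⊆ 𝒞 := by
    refine Finset.insert_subset hK₀ fun K hK => ?_
    obtain ⟨⟨P, v⟩, -, rfl⟩ := Finset.mem_image.1 hK
    obtain ⟨x, y, hgen⟩ := exists_pair_generating_pointStabilizer hρ P.rep_nonzero v
    obtain ⟨L, hL, hxL, hyL⟩ := h𝒞.2 x y
    rw [projectiveStabilizer,
      ← eq_pointStabilizer_of_le hρ.span_range P.rep_nonzero (hgen L hxL hyL) (h𝒞.1 L hL)]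
    exact hL
  refine le_trans (le_of_eq ?_) (Finset.card_le_card hsub)
  rw [Finset.card_insert_of_notMem hnot,
    Finset.card_image_of_injective _ (projectiveStabilizer_injective hρ), Finset.card_univ,
    ← Nat.card_eq_fintype_card, card_projective_prod]
  ring

lemma sigma2_eq [Nontrivial H] (hρ : IsQuaternionic ρ i j) :
    sigma2 (MatrixExtension ρ) = 1 + p ^ 2 + p ^ 3 + p ^ 4 :=
  IsLeast.csInf_eq ⟨exists_isTwoCovering hρ,
    fun _ ⟨_, h𝒞, hcard⟩ => hcard ▸ le_card_of_isTwoCovering hρ h𝒞⟩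

lemma closure_pair_ne_top [Nontrivial H] (hρ : IsQuaternionic ρ i j)
    (x y : MatrixExtension ρ) : Subgroup.closure {x, y} ≠ ⊤ := by
  obtain ⟨𝒞, ⟨hproper, hcover⟩, -⟩ := exists_isTwoCovering hρ
  obtain ⟨K, hK, hx, hy⟩ := hcover x y
  exact ne_top_of_le_ne_top (hproper K hK)
    ((Subgroup.closure_le K).2 (Set.insert_subset hx (Set.singleton_subset_iff.2 hy)))

end Prime

end MatrixExtension

section Quaternion

variable {R : Type*} [Ring R] {I J : R}

/-- The homomorphism from the quaternion group of order eight determined by two anticommuting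
square roots of `-1`. -/
def quaternionLift (hI : I * I = -1) (hJ : J * J = -1) (hIJ : I * J = -(J * I)) :
    QuaternionGroup 2 →* R :=
  have hI4 : I ^ 4 = 1 := by rw [show 4 = 2 * 2 from rfl, pow_mul, pow_two I, hI, neg_one_sq]
  have hadd : ∀ k l : ZMod 4, I ^ (k + l).val = I ^ k.val * I ^ l.val := fun k l => by
    rw [ZMod.val_add, ← pow_eq_pow_mod _ hI4, pow_add]
  have hJI : ∀ k : ZMod 4, I ^ k.val * J = J * I ^ (-k).val := fun k => by
    have h3 : I ^ 3 = -I := by rw [pow_succ, pow_two, hI, neg_one_mul]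
    fin_cases k
    · change I ^ 0 * J = J * I ^ 0
      simp
    · change I ^ 1 * J = J * I ^ 3
      rw [h3, pow_one, hIJ, mul_neg]
    · change I ^ 2 * J = J * I ^ 2
      simp [pow_two, hI]
    · change I ^ 3 * J = J * I ^ 1
      rw [h3, pow_one, neg_mul, hIJ, neg_neg]
  { toFun := fun
      | .a k => I ^ (k : ZMod 4).val
      | .xa k => J * I ^ (k : ZMod 4).val
    map_one' := pow_zero I
    map_mul' := by
      have h2 : I ^ (2 : ZMod 4).val = -1 := by
        change I ^ 2 = -1
        rw [pow_two, hI]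
      rintro (k | k) (l | l)
      · exact hadd k l
      · change J * I ^ (l - k : ZMod 4).val = I ^ (k : ZMod 4).val * (J * I ^ (l : ZMod 4).val)
        rw [sub_eq_neg_add, hadd, ← mul_assoc, ← hJI, mul_assoc]
      · change J * I ^ (k + l : ZMod 4).val = J * I ^ (k : ZMod 4).val * I ^ (l : ZMod 4).val
        rw [hadd, mul_assoc]
      · change I ^ (2 + l - k : ZMod 4).val =
          J * I ^ (k : ZMod 4).val * (J * I ^ (l : ZMod 4).val)
        rw [add_sub_assoc, sub_eq_neg_add, hadd, hadd, h2, mul_assoc, ← mul_assoc (I ^ _) J, hJI,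
          mul_assoc, ← mul_assoc J J, hJ] }

@[simp] lemma quaternionLift_a (hI : I * I = -1) (hJ : J * J = -1) (hIJ : I * J = -(J * I))
    (k : ZMod 4) : quaternionLift hI hJ hIJ (.a k) = I ^ k.val := rfl

@[simp] lemma quaternionLift_xa (hI : I * I = -1) (hJ : J * J = -1) (hIJ : I * J = -(J * I))
    (k : ZMod 4) : quaternionLift hI hJ hIJ (.xa k) = J * I ^ k.val := rfl

lemma QuaternionGroup.eq_top_of_mem {n : ℕ} [NeZero n] (S : Subgroup (QuaternionGroup n))
    (ha : .a 1 ∈ S) (hxa : .xa 0 ∈ S) : S = ⊤ := by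
  have hpow : ∀ k : ZMod (2 * n), QuaternionGroup.a k ∈ S := fun k => by
    have := S.pow_mem ha k.val
    rwa [QuaternionGroup.a_one_pow, ZMod.natCast_zmod_val] at this
  refine eq_top_iff.2 fun g _ => ?_
  rcases g with k | k
  · exact hpow k
  · have := S.mul_mem hxa (hpow k)
    rwa [QuaternionGroup.xa_mul_a, zero_add] at this

instance : Group.IsSolvable (QuaternionGroup 2) := by
  have : Fact (Nat.Prime 2) := ⟨Nat.prime_two⟩
  have := (IsPGroup.of_card (p := 2) (n := 3) (G := QuaternionGroup 2)
    (by rw [Nat.card_eq_fintype_card, QuaternionGroup.card]; rfl)).isNilpotent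
  infer_instance

lemma QuaternionGroup.eq_or_mul_self_eq_of_ne_one :
    ∀ h : QuaternionGroup 2, h ≠ 1 → h = .a 2 ∨ h * h = .a 2 := by
  decide

end Quaternion

/-- In odd characteristic the quaternion group of order eight has a two-dimensional representation
that is fixed point free and absolutely irreducible. -/
lemma exists_isQuaternionic {p : ℕ} [Fact p.Prime] (hodd : Odd p) :
    ∃ ρ : QuaternionGroup 2 →* Matrix (Fin 2) (Fin 2) (ZMod p),
      MatrixExtension.IsQuaternionic ρ (.a 1) (.xa 0) := by
  have h2 : (2 : ZMod p) ≠ 0 := by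
    have : Fact (2 < p) := ⟨lt_of_le_of_ne (Fact.out : p.Prime).two_le
      (by rintro rfl; contradiction)⟩
    exact (ZMod.neg_one_ne_one (n := p)).symm ∘ fun h => by linear_combination h
  obtain ⟨a, b, hab⟩ := ZMod.sq_add_sq p (-1)
  let I : Matrix (Fin 2) (Fin 2) (ZMod p) := !![a, b; b, -a]
  let J : Matrix (Fin 2) (Fin 2) (ZMod p) := !![0, 1; -1, 0]
  have hI : I * I = -1 := by
    ext k l
    fin_cases k <;> fin_cases l <;> simp [I] <;> first | ring1 | linear_combination hab
  have hJ : J * J = -1 := by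
    ext k l
    fin_cases k <;> fin_cases l <;> simp [J]
  have hIJ : I * J = -(J * I) := by
    ext k l
    fin_cases k <;> fin_cases l <;> simp [I, J]
  let ρ := quaternionLift hI hJ hIJ
  have hρI : ρ (.a 1) = I := pow_one I
  have hρJ : ρ (.xa 0) = J := mul_one J
  have hρ2 : ρ (.a 2) = -1 := (pow_two I).trans hI
  refine ⟨ρ, ?_, ?_, rfl, ?_, QuaternionGroup.eq_top_of_mem⟩
  · intro h hne w hw
    have hneg : ρ (.a 2) *ᵥ w = w := by
      rcases QuaternionGroup.eq_or_mul_self_eq_of_ne_one h hne with rfl | hh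
      · exact hw
      · rw [← hh, map_mul, ← mulVec_mulVec, hw, hw]
    rw [hρ2, neg_mulVec, one_mulVec] at hneg
    have h0 : (2 : ZMod p) • w = 0 := by
      rw [two_smul]
      nth_rw 1 [← hneg]
      exact neg_add_cancel w
    exact (smul_eq_zero.1 h0).resolve_left h2
  · refine eq_top_iff.2 fun X _ => ?_
    have hX : X = ((X 0 0 + X 1 1) / 2) • ρ 1
        + (-(a * (X 0 0 - X 1 1) + b * (X 0 1 + X 1 0)) / 2) • ρ (.a 1)
        + ((X 0 1 - X 1 0) / 2) • ρ (.xa 0)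
        + ((b * (X 0 0 - X 1 1) - a * (X 0 1 + X 1 0)) / 2) • ρ (.a 1 * .xa 0) := by
      rw [map_mul, map_one, hρI, hρJ]
      ext k l
      fin_cases k <;> fin_cases l <;> simp [I, J] <;> field_simp
      · linear_combination (X 0 0 - X 1 1) * hab
      · linear_combination (X 0 1 + X 1 0) * hab
      · linear_combination (X 0 1 + X 1 0) * hab
      · linear_combination (X 1 1 - X 0 0) * hab
    rw [hX]
    have hmem : ∀ (s : ZMod p) (h : QuaternionGroup 2),
        s • ρ h ∈ Submodule.span (ZMod p) (Set.range ρ) := fun s h =>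
      Submodule.smul_mem _ s (Submodule.subset_span ⟨h, rfl⟩)
    exact add_mem (add_mem (add_mem (hmem _ _) (hmem _ _)) (hmem _ _)) (hmem _ _)
  · rw [hρI]
    refine IsUnit.of_mul_eq_one ((2 : ZMod p)⁻¹ • (1 - I)) ?_
    rw [Matrix.mul_smul, Matrix.mul_sub, Matrix.mul_one, Matrix.add_mul, Matrix.one_mul, hI]
    have : (1 + I - (I + -1) : Matrix (Fin 2) (Fin 2) (ZMod p)) = (2 : ZMod p) • 1 := by
      rw [two_smul]
      abel
    rw [this, smul_smul, inv_mul_cancel₀ h2, one_smul]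

/-- For every odd prime `p`, there exists a finite solvable group `G`, not generated
by two elements (i.e. `d(G) ≥ 3`, so that `G` admits a 2-covering), such that
`σ₂(G) = 1 + p² + p³ + p⁴`. -/
theorem exists_solvable_sigma2_eq_one_add_sq_add_cube_add_fourth
    (p : ℕ) (hp : p.Prime) (hodd : Odd p) :
    ∃ (G : Type) (_ : Group G), Finite G ∧ IsSolvable G ∧
      (∀ x y : G, Subgroup.closure {x, y} ≠ ⊤) ∧
      sigma2 G = 1 + p ^ 2 + p ^ 3 + p ^ 4 := by
  have : Fact p.Prime := ⟨hp⟩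
  obtain ⟨ρ, hρ⟩ := exists_isQuaternionic hodd
  exact ⟨MatrixExtension ρ, inferInstance, inferInstance, MatrixExtension.isSolvable,
    MatrixExtension.closure_pair_ne_top hρ, MatrixExtension.sigma2_eq hρ⟩
end

section
/- There exist infinitely many even positive integers n such that n = σ₂(G) for some finite solvable group G with d(G) ≥ 3. (For instance, for every odd prime p the even number 1 + p² + p³ + p⁴ is the 2-covering number of a finite solvable group.) -/
open scoped Matrix LinearAlgebra.Projectivization

/-- A group with a 2-covering is not generated by two elements. -/
lemma IsTwoCovering.closure_pair_ne_top {G : Type*} [Group G] {𝒞 : Finset (Subgroup G)}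
    (h : IsTwoCovering 𝒞) (x y : G) : Subgroup.closure {x, y} ≠ ⊤ := by
  obtain ⟨H, hH, hx, hy⟩ := h.2 x y
  intro h1
  refine h.1 H hH (top_le_iff.1 (h1 ▸ (Subgroup.closure_le _).2 ?_))
  rintro z (rfl | rfl) <;> assumption

lemma IsTwoCovering.sigma2_le {G : Type*} [Group G] {𝒞 : Finset (Subgroup G)}
    (h : IsTwoCovering 𝒞) : sigma2 G ≤ 𝒞.card := Nat.sInf_le ⟨𝒞, h, rfl⟩

/-- The monomial matrices in `SL(2, F)`, that is, the normalizer of the diagonal torus. -/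
def monomialSL (F : Type*) [Field F] : Subgroup (Matrix.SpecialLinearGroup (Fin 2) F) where
  carrier := {g | g 0 1 = 0 ∧ g 1 0 = 0 ∨ g 0 0 = 0 ∧ g 1 1 = 0}
  one_mem' := by simp
  mul_mem' := by
    rintro a b (⟨h1, h2⟩ | ⟨h1, h2⟩) (⟨h3, h4⟩ | ⟨h3, h4⟩) <;>
      simp [Matrix.mul_apply, Fin.sum_univ_two, h1, h2, h3, h4]
  inv_mem' := by
    rintro a (⟨h1, h2⟩ | ⟨h1, h2⟩)
    · exact Or.inl (by simp [Matrix.SpecialLinearGroup.SL2_inv_expl, h1, h2])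
    · exact Or.inr (by simp [Matrix.SpecialLinearGroup.SL2_inv_expl, h1, h2])

namespace monomialSL

variable {F : Type*} [Field F]

/-- The underlying matrix of a monomial matrix of determinant one. -/
def mat (h : monomialSL F) : Matrix (Fin 2) (Fin 2) F := h.1.1

@[simp] lemma mat_one : mat (1 : monomialSL F) = 1 := rfl

@[simp] lemma mat_mul (h k : monomialSL F) : mat (h * k) = mat h * mat k := by
  simp [mat]

lemma mat_injective : Function.Injective (mat : monomialSL F → _) := fun _ _ h =>
  Subtype.ext (Subtype.ext h)

@[simp] lemma mat_inv_mul (h : monomialSL F) : mat h⁻¹ * mat h = 1 := by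
  rw [← mat_mul]; simp

lemma det_mat (h : monomialSL F) : mat h 0 0 * mat h 1 1 - mat h 0 1 * mat h 1 0 = 1 := by
  rw [← Matrix.det_fin_two]; exact h.1.2

lemma mat_cases (h : monomialSL F) :
    mat h 0 1 = 0 ∧ mat h 1 0 = 0 ∨ mat h 0 0 = 0 ∧ mat h 1 1 = 0 := h.2

/-- Monomial matrices of determinant one act without nonzero fixed points. -/
lemma isUnit_one_sub (two : (2 : F) ≠ 0) {h : monomialSL F} (hh : h ≠ 1) :
    IsUnit (1 - mat h) := by
  rw [Matrix.isUnit_iff_isUnit_det, isUnit_iff_ne_zero, Matrix.det_fin_two]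
  have hd := det_mat h
  intro h0
  simp only [Matrix.sub_apply, Matrix.one_apply, Fin.isValue, ite_true, zero_ne_one, ite_false,
    one_ne_zero] at h0
  rcases mat_cases h with ⟨h1, h2⟩ | ⟨h1, h2⟩
  · apply hh
    apply mat_injective
    rw [h1, h2] at h0 hd
    have h3 : (mat h 0 0 - 1) ^ 2 = 0 := by
      linear_combination (-mat h 0 0) * h0 + (mat h 0 0 - 1) * hd
    have h4 : mat h 0 0 = 1 := by
      have := pow_eq_zero_iff (two_ne_zero) |>.1 h3
      linear_combination this
    have h5 : mat h 1 1 = 1 := by rw [h4] at hd; linear_combination hd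
    ext i j
    fin_cases i <;> fin_cases j <;> simp [h1, h2, h4, h5]
  · rw [h1, h2] at h0 hd
    exact two (by linear_combination h0 - hd)

/-- The diagonal torus. -/
def torus : Fˣ →* monomialSL F where
  toFun a := ⟨⟨!![(a : F), 0; 0, (a⁻¹ : Fˣ)], by simp [Matrix.det_fin_two]⟩, Or.inl (by simp)⟩
  map_one' := mat_injective (by simp [mat, Matrix.one_fin_two])
  map_mul' a b := mat_injective (by
    rw [mat_mul]
    simp [mat, mul_comm])

lemma mat_torus (a : Fˣ) : mat (torus a) = !![(a : F), 0; 0, (a⁻¹ : Fˣ)] := rfl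

/-- The antidiagonal element of order four. -/
def weyl : monomialSL F :=
  ⟨⟨!![0, 1; -1, 0], by simp [Matrix.det_fin_two]⟩, Or.inr (by simp)⟩

lemma mat_weyl : mat (weyl : monomialSL F) = !![0, 1; -1, 0] := rfl

lemma mat_weyl_mul_self : mat (weyl : monomialSL F) * mat weyl = -1 := by
  rw [mat_weyl]
  ext i j
  fin_cases i <;> fin_cases j <;> simp

lemma mat_weyl_mul_mul {n : Type*} (X : Matrix (Fin 2) n F) :
    mat (weyl : monomialSL F) * (mat (weyl : monomialSL F) * X) = -X := by
  rw [← Matrix.mul_assoc, mat_weyl_mul_self, Matrix.neg_mul, Matrix.one_mul]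

lemma mat_torus_neg_one : mat (torus (-1 : Fˣ)) = -1 := by
  rw [mat_torus]
  ext i j
  fin_cases i <;> fin_cases j <;> simp

lemma exists_torus_of_apply_eq_zero {h : monomialSL F} (h1 : mat h 0 1 = 0) (h2 : mat h 1 0 = 0) :
    ∃ a, h = torus a := by
  have hd := det_mat h
  rw [h1, h2, zero_mul, sub_zero] at hd
  refine ⟨⟨mat h 0 0, mat h 1 1, hd, by rw [mul_comm, hd]⟩, mat_injective ?_⟩
  rw [mat_torus]
  ext i j
  fin_cases i <;> fin_cases j <;> simp [h1, h2]

lemma exists_torus (h : monomialSL F) : ∃ a, h = torus a ∨ h = torus a * weyl := by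
  rcases mat_cases h with ⟨h1, h2⟩ | ⟨h1, h2⟩
  · obtain ⟨a, ha⟩ := exists_torus_of_apply_eq_zero h1 h2
    exact ⟨a, Or.inl ha⟩
  · have key : mat (h * weyl) 0 1 = 0 ∧ mat (h * weyl) 1 0 = 0 := by
      simp [mat_weyl, Matrix.mul_apply, Fin.sum_univ_two, h1, h2]
    obtain ⟨a, ha⟩ := exists_torus_of_apply_eq_zero key.1 key.2
    refine ⟨-a, Or.inr (mat_injective ?_)⟩
    have h3 : mat h * mat weyl = mat (torus a) := by rw [← mat_mul, ha]
    have h5 : mat (torus (-a)) = -mat (torus a) := by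
      rw [mat_torus, mat_torus]; ext i j; fin_cases i <;> fin_cases j <;> simp
    rw [mat_mul, h5, ← h3, neg_mul, mul_assoc, mat_weyl_mul_self]
    simp

/-- A generator of the torus and the antidiagonal element generate. -/
lemma eq_top_of_mem {g : Fˣ} (hg : ∀ a, a ∈ Subgroup.zpowers g) {S : Subgroup (monomialSL F)}
    (h1 : torus g ∈ S) (h2 : weyl ∈ S) : S = ⊤ := by
  have h3 : ∀ a, torus a ∈ S := fun a => by
    obtain ⟨k, rfl⟩ := hg a
    simpa using S.zpow_mem h1 k
  refine (Subgroup.eq_top_iff' _).2 fun h => ?_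
  obtain ⟨a, rfl | rfl⟩ := exists_torus h
  · exact h3 a
  · exact S.mul_mem (h3 a) h2

/-- The permanent, which is multiplicative on monomial matrices. -/
def perm : monomialSL F →* F where
  toFun h := mat h 0 0 * mat h 1 1 + mat h 0 1 * mat h 1 0
  map_one' := by simp
  map_mul' h k := by
    rcases mat_cases h with ⟨h1, h2⟩ | ⟨h1, h2⟩ <;> rcases mat_cases k with ⟨h3, h4⟩ | ⟨h3, h4⟩ <;>
      simp [Matrix.mul_apply, Fin.sum_univ_two, h1, h2, h3, h4] <;> ring

lemma isSolvable (two : (2 : F) ≠ 0) : Group.IsSolvable (monomialSL F) := by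
  refine Group.isSolvable_of_ker_le_range (torus (F := F)) (perm (F := F)).toHomUnits fun h hh => ?_
  have h1 : mat h 0 0 * mat h 1 1 + mat h 0 1 * mat h 1 0 = 1 :=
    congrArg Units.val (MonoidHom.mem_ker.1 hh)
  have hd := det_mat h
  rcases mat_cases h with ⟨h2, h3⟩ | ⟨h2, h3⟩
  · obtain ⟨a, rfl⟩ := exists_torus_of_apply_eq_zero h2 h3
    exact ⟨a, rfl⟩
  · rw [h2] at h1 hd
    exact absurd (by linear_combination -h1 - hd) two

/-- Additive subgroups stable under the monomial matrices are stable under all matrices. -/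
lemma mul_mem_of_stable {p : ℕ} [Fact p.Prime] (two : (2 : ZMod p) ≠ 0) (three : (3 : ZMod p) ≠ 0)
    {n : Type*} (L : AddSubgroup (Matrix (Fin 2) n (ZMod p)))
    (hL : ∀ (h : monomialSL (ZMod p)), ∀ X ∈ L, mat h * X ∈ L)
    (B : Matrix (Fin 2) (Fin 2) (ZMod p)) {X : Matrix (Fin 2) n (ZMod p)} (hX : X ∈ L) :
    B * X ∈ L := by
  set D := mat (torus (Units.mk0 (2 : ZMod p) two)) with hD
  have hsmul : ∀ (c : ZMod p) (Y : Matrix (Fin 2) n (ZMod p)), Y ∈ L → c • Y ∈ L :=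
    fun c Y hY => ZMod.smul_mem hY c
  have hE : ∀ (b c : ZMod p) (Y : Matrix (Fin 2) n (ZMod p)), Y ∈ L → !![b, 0; 0, c] * Y ∈ L := by
    intro b c Y hY
    have : !![b, 0; 0, c] = ((b - c) * (2 / 3)) • D + (c - (b - c) * (1 / 3)) • 1 := by
      rw [hD, mat_torus]
      ext i j
      fin_cases i <;> fin_cases j <;> simp <;> field_simp <;> ring
    rw [this, Matrix.add_mul, Matrix.smul_mul, Matrix.smul_mul, Matrix.one_mul]
    exact L.add_mem (hsmul _ _ (hL _ _ hY)) (hsmul _ _ hY)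
  have hsplit : B = !![B 0 0, 0; 0, B 1 1] + !![B 0 1, 0; 0, -B 1 0] * mat weyl := by
    rw [mat_weyl]
    ext i j
    fin_cases i <;> fin_cases j <;> simp
  have hmul := congrArg (· * X) hsplit
  simp only [Matrix.add_mul, Matrix.mul_assoc] at hmul
  rw [hmul]
  exact L.add_mem (hE _ _ _ hX) (hE _ _ _ (hL _ _ hX))

end monomialSL

open monomialSL

/-- The semidirect product of the space of `2 × 3` matrices by the group of monomial matrices of
determinant one, acting by left multiplication. -/
@[ext] structure MatrixExt (F : Type*) [Field F] where
  /-- The matrix part. -/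
  trans : Matrix (Fin 2) (Fin 3) F
  /-- The monomial part. -/
  lin : monomialSL F

namespace MatrixExt

section Field

variable {F : Type*} [Field F]

instance : Mul (MatrixExt F) := ⟨fun x y => ⟨x.trans + mat x.lin * y.trans, x.lin * y.lin⟩⟩
instance : One (MatrixExt F) := ⟨⟨0, 1⟩⟩
instance : Inv (MatrixExt F) := ⟨fun x => ⟨-(mat x.lin⁻¹ * x.trans), x.lin⁻¹⟩⟩

@[simp] lemma mul_trans (x y : MatrixExt F) : (x * y).trans = x.trans + mat x.lin * y.trans := rfl
@[simp] lemma mul_lin (x y : MatrixExt F) : (x * y).lin = x.lin * y.lin := rfl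
@[simp] lemma one_trans : (1 : MatrixExt F).trans = 0 := rfl
@[simp] lemma one_lin : (1 : MatrixExt F).lin = 1 := rfl
@[simp] lemma inv_trans (x : MatrixExt F) : x⁻¹.trans = -(mat x.lin⁻¹ * x.trans) := rfl
@[simp] lemma inv_lin (x : MatrixExt F) : x⁻¹.lin = x.lin⁻¹ := rfl

instance : Group (MatrixExt F) :=
  Group.ofLeftAxioms
    (fun _ _ _ => by ext1 <;> simp [Matrix.mul_add, mul_assoc, Matrix.mul_assoc, add_assoc])
    (fun x => by ext1 <;> simp)
    (fun x => by ext1 <;> simp)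

instance [Finite F] : Finite (MatrixExt F) :=
  Finite.of_injective (fun x : MatrixExt F => (x.trans, x.lin)) fun _ _ h =>
    MatrixExt.ext (congrArg Prod.fst h) (congrArg Prod.snd h)

/-- The projection to the monomial part. -/
def linHom : MatrixExt F →* monomialSL F where
  toFun := lin
  map_one' := rfl
  map_mul' _ _ := rfl

/-- The inclusion of the matrix part. -/
def ofMatrix : Multiplicative (Matrix (Fin 2) (Fin 3) F) →* MatrixExt F where
  toFun X := ⟨X.toAdd, 1⟩
  map_one' := rfl
  map_mul' _ _ := by ext1 <;> simp

lemma isSolvable (two : (2 : F) ≠ 0) : Group.IsSolvable (MatrixExt F) := by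
  have := monomialSL.isSolvable two
  refine Group.isSolvable_of_ker_le_range (ofMatrix (F := F)) linHom fun x hx => ?_
  exact ⟨Multiplicative.ofAdd x.trans, MatrixExt.ext rfl (MonoidHom.mem_ker.1 hx).symm⟩

/-- The complement of the matrix part that is conjugate to the standard one by `T`. -/
def conjSection (T : Matrix (Fin 2) (Fin 3) F) : monomialSL F →* MatrixExt F where
  toFun h := ⟨T - mat h * T, h⟩
  map_one' := by ext1 <;> simp
  map_mul' h k := by ext1 <;> simp [Matrix.mul_sub, Matrix.mul_assoc]

@[simp] lemma conjSection_trans (T : Matrix (Fin 2) (Fin 3) F) (h : monomialSL F) :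
    (conjSection T h).trans = T - mat h * T := rfl
@[simp] lemma conjSection_lin (T : Matrix (Fin 2) (Fin 3) F) (h : monomialSL F) :
    (conjSection T h).lin = h := rfl

/-- The stabilizer of `c` in the affine action on `F²` defined by `u`. -/
def stab (u : Fin 3 → F) (c : Fin 2 → F) : Subgroup (MatrixExt F) where
  carrier := {x | x.trans *ᵥ u + mat x.lin *ᵥ c = c}
  one_mem' := by
    change (0 : Matrix (Fin 2) (Fin 3) F) *ᵥ u + (1 : Matrix (Fin 2) (Fin 2) F) *ᵥ c = c
    rw [Matrix.zero_mulVec, Matrix.one_mulVec, zero_add]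
  mul_mem' {x y} hx hy := by
    simp only [Set.mem_ofPred_eq] at hx hy ⊢
    rw [mul_trans, mul_lin, mat_mul, Matrix.add_mulVec, add_assoc, ← Matrix.mulVec_mulVec,
      ← Matrix.mulVec_mulVec, ← Matrix.mulVec_add, hy, hx]
  inv_mem' {x} hx := by
    simp only [Set.mem_ofPred_eq] at hx ⊢
    have h := congrArg (mat x.lin⁻¹ *ᵥ ·) hx
    simp only [Matrix.mulVec_add, Matrix.mulVec_mulVec, mat_inv_mul, Matrix.one_mulVec] at h
    rw [inv_trans, inv_lin, Matrix.neg_mulVec, ← h, neg_add_cancel_left]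

lemma mem_stab {u : Fin 3 → F} {c : Fin 2 → F} {x : MatrixExt F} :
    x ∈ stab u c ↔ x.trans *ᵥ u + mat x.lin *ᵥ c = c := Iff.rfl

lemma mem_stab_mulVec {u : Fin 3 → F} {T : Matrix (Fin 2) (Fin 3) F} {x : MatrixExt F} :
    x ∈ stab u (T *ᵥ u) ↔ (x.trans - (T - mat x.lin * T)) *ᵥ u = 0 := by
  rw [mem_stab, Matrix.sub_mulVec, Matrix.sub_mulVec, ← Matrix.mulVec_mulVec, sub_eq_zero,
    eq_sub_iff_add_eq]

/-- The matrices contained in a subgroup. -/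
def matrixPart (K : Subgroup (MatrixExt F)) : AddSubgroup (Matrix (Fin 2) (Fin 3) F) :=
  Subgroup.toAddSubgroup' (K.comap ofMatrix)

lemma mem_matrixPart {K : Subgroup (MatrixExt F)} {X : Matrix (Fin 2) (Fin 3) F} :
    X ∈ matrixPart K ↔ (⟨X, 1⟩ : MatrixExt F) ∈ K := Iff.rfl

lemma mul_mem_matrixPart {K : Subgroup (MatrixExt F)} {x : MatrixExt F} (hx : x ∈ K)
    {X : Matrix (Fin 2) (Fin 3) F} (hX : X ∈ matrixPart K) : mat x.lin * X ∈ matrixPart K := by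
  rw [mem_matrixPart] at hX ⊢
  convert K.mul_mem (K.mul_mem hx hX) (K.inv_mem hx) using 1
  ext1
  · simp [← Matrix.mul_assoc, ← mat_mul]
  · simp

lemma sub_mem_matrixPart {K : Subgroup (MatrixExt F)} {x y : MatrixExt F} (hx : x ∈ K)
    (hy : y ∈ K) (h : x.lin = y.lin) : x.trans - y.trans ∈ matrixPart K := by
  rw [mem_matrixPart]
  convert K.mul_mem hx (K.inv_mem hy) using 1
  ext1
  · simp [h, ← Matrix.mul_assoc, ← mat_mul, sub_eq_add_neg]
  · simp [h]

lemma mem_of_sub_mem_matrixPart {K : Subgroup (MatrixExt F)} {x y : MatrixExt F}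
    (hy : y ∈ K) (h : x.lin = y.lin) (hxy : x.trans - y.trans ∈ matrixPart K) : x ∈ K := by
  rw [mem_matrixPart] at hxy
  convert K.mul_mem hxy hy using 1
  ext1 <;> simp [h]

end Field

section LinearAlgebra

variable {F : Type*} [Field F]

lemma exists_mulVec_eq {m n : Type*} [Fintype n] [DecidableEq n] {u : n → F} (hu : u ≠ 0)
    (c : m → F) : ∃ T : Matrix m n F, T *ᵥ u = c := by
  obtain ⟨k, hk⟩ := Function.ne_iff.1 hu
  refine ⟨Matrix.vecMulVec c (Pi.single k (u k)⁻¹), ?_⟩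
  ext i
  simp [Matrix.vecMulVec_mulVec, inv_mul_cancel₀ hk]

lemma exists_mulVec_eq_zero (Z : Matrix (Fin 2) (Fin 3) F) : ∃ u ≠ 0, Z *ᵥ u = 0 := by
  have h : (Matrix.mulVecLin Z).ker ≠ ⊥ := LinearMap.ker_ne_bot_of_finrank_lt (by simp)
  obtain ⟨u, hu, hu0⟩ := (Submodule.ne_bot_iff _).1 h
  exact ⟨u, hu0, by simpa using hu⟩

/-- A surjective matrix whose kernel is a given line. -/
lemma exists_matrix_ker_eq {u : Fin 3 → F} (hu : u ≠ 0) :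
    ∃ (W : Matrix (Fin 2) (Fin 3) F) (R : Matrix (Fin 3) (Fin 2) F),
      W * R = 1 ∧ W *ᵥ u = 0 ∧ ∀ v, W *ᵥ v = 0 → ∃ a : F, a • u = v := by
  have h2 : Module.finrank F ((Fin 3 → F) ⧸ Submodule.span F {u}) =
      Module.finrank F (Fin 2 → F) := by
    have := Submodule.finrank_quotient_add_finrank (Submodule.span F {u})
    rw [finrank_span_singleton hu] at this
    simp at this ⊢
    omega
  let e := LinearEquiv.ofFinrankEq _ _ h2
  let f := e.toLinearMap ∘ₗ (Submodule.span F {u}).mkQ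
  have hf : Function.Surjective f := e.surjective.comp (Submodule.mkQ_surjective _)
  obtain ⟨g, hg⟩ := LinearMap.exists_rightInverse_of_surjective f (LinearMap.range_eq_top.2 hf)
  have hker : ∀ v, f v = 0 ↔ ∃ a : F, a • u = v := fun v => by
    simp [f, Submodule.mem_span_singleton]
  refine ⟨LinearMap.toMatrix' f, LinearMap.toMatrix' g, ?_, ?_, fun v hv => ?_⟩
  · rw [← LinearMap.toMatrix'_comp, hg, LinearMap.toMatrix'_id]
  · rw [LinearMap.toMatrix'_mulVec]
    exact (hker u).2 ⟨1, one_smul _ _⟩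
  · rw [LinearMap.toMatrix'_mulVec] at hv
    exact (hker v).1 hv

lemma mul_mul_eq_of_mulVec_eq_zero {u : Fin 3 → F} {W X : Matrix (Fin 2) (Fin 3) F}
    {R : Matrix (Fin 3) (Fin 2) F} (hWR : W * R = 1)
    (hW : ∀ v, W *ᵥ v = 0 → ∃ a : F, a • u = v) (hX : X *ᵥ u = 0) : X * R * W = X := by
  symm
  rw [← sub_eq_zero, ← Matrix.mulVec_injective.eq_iff]
  ext1 v
  obtain ⟨a, ha⟩ := hW (v - (R * W) *ᵥ v) (by
    rw [Matrix.mulVec_sub, Matrix.mulVec_mulVec, ← Matrix.mul_assoc, hWR, Matrix.one_mul, sub_self])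
  rw [Matrix.sub_mulVec, Matrix.mul_assoc, ← Matrix.mulVec_mulVec, ← Matrix.mulVec_sub, ← ha,
    Matrix.mulVec_smul, hX]
  simp

end LinearAlgebra

variable {p : ℕ} [Fact p.Prime]

/-- For `u ≠ 0`, some pair of elements of `stab u c` lies in no other proper subgroup. -/
lemma exists_pair (two : (2 : ZMod p) ≠ 0) (three : (3 : ZMod p) ≠ 0) {u : Fin 3 → ZMod p}
    (hu : u ≠ 0) (c : Fin 2 → ZMod p) :
    ∃ x y : MatrixExt (ZMod p), ∀ K : Subgroup (MatrixExt (ZMod p)),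
      K ≠ ⊤ → x ∈ K → y ∈ K → K = stab u c := by
  obtain ⟨T, rfl⟩ := exists_mulVec_eq hu c
  obtain ⟨W, R, hWR, -, hW⟩ := exists_matrix_ker_eq hu
  obtain ⟨g, hg⟩ := IsCyclic.exists_generator (α := (ZMod p)ˣ)
  refine ⟨conjSection T (torus g), ⟨(conjSection T weyl).trans + W, weyl⟩, fun K hK hx hy => ?_⟩
  have hlin : ∀ h, ∃ z ∈ K, z.lin = h := by
    have : K.map linHom = ⊤ := eq_top_of_mem hg ⟨_, hx, rfl⟩ ⟨_, hy, rfl⟩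
    intro h
    exact (this ▸ Subgroup.mem_top h : h ∈ K.map linHom)
  have hB := fun B X hX => mul_mem_of_stable two three (matrixPart K) (fun h X hX => by
    obtain ⟨z, hz, rfl⟩ := hlin h
    exact mul_mem_matrixPart hz hX) B (X := X) hX
  have hneg : conjSection T (torus (-1)) ∈ K := by
    obtain ⟨k, hk⟩ := hg (-1)
    simpa [← hk] using K.zpow_mem hx k
  have hW1 : ((1 : Matrix (Fin 2) (Fin 2) (ZMod p)) + mat weyl) * W ∈ matrixPart K := by
    convert sub_mem_matrixPart (K.mul_mem hy hy) hneg (mat_injective ?_) using 1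
    · simp only [mul_trans, conjSection_trans, mat_torus_neg_one, Matrix.mul_add, Matrix.mul_sub,
        mat_weyl_mul_mul, Matrix.add_mul, Matrix.neg_mul, Matrix.one_mul]
      abel
    · simp [mat_weyl_mul_self, mat_torus_neg_one]
  have hW2 : W ∈ matrixPart K := by
    have := hB ((2 : ZMod p)⁻¹ • (1 - mat weyl)) _ hW1
    have h2 : (1 - mat weyl) * (1 + mat weyl) =
        (2 : ZMod p) • (1 : Matrix (Fin 2) (Fin 2) (ZMod p)) := by
      rw [two_smul, sub_mul, mul_add, mul_add, mat_weyl_mul_self]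
      simp only [one_mul, mul_one]
      abel
    rwa [← Matrix.mul_assoc, smul_mul_assoc, h2, smul_smul, inv_mul_cancel₀ two, one_smul,
      Matrix.one_mul] at this
  have hker : ∀ X : Matrix (Fin 2) (Fin 3) (ZMod p), X *ᵥ u = 0 → X ∈ matrixPart K := fun X hX => by
    rw [← mul_mul_eq_of_mulVec_eq_zero hWR hW hX]
    exact hB _ _ hW2
  have hsec : ∀ h, conjSection T h ∈ K := by
    have : K.comap (conjSection T) = ⊤ := by
      refine eq_top_of_mem hg hx (mem_of_sub_mem_matrixPart hy rfl ?_)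
      convert (matrixPart K).neg_mem hW2 using 1
      exact sub_add_cancel_left _ _
    intro h
    exact (this ▸ Subgroup.mem_top h : h ∈ K.comap (conjSection T))
  refine le_antisymm (fun z hz => ?_) fun z hz => ?_
  · by_contra hzs
    refine hK ((Subgroup.eq_top_iff' _).2 fun y => ?_)
    rw [mem_stab_mulVec] at hzs
    refine mem_of_sub_mem_matrixPart (hsec y.lin) rfl ?_
    set X := y.trans - (conjSection T y.lin).trans
    obtain ⟨B, hBX⟩ := exists_mulVec_eq hzs (X *ᵥ u)
    have h1 := hB B _ (sub_mem_matrixPart hz (hsec z.lin) rfl)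
    have h2 := hker (X - B * (z.trans - (T - mat z.lin * T))) (by
      rw [Matrix.sub_mulVec, ← Matrix.mulVec_mulVec, hBX, sub_self])
    simpa using (matrixPart K).add_mem h1 h2
  · exact mem_of_sub_mem_matrixPart (hsec z.lin) rfl (hker _ (mem_stab_mulVec.1 hz))

lemma stab_ne_top {F : Type*} [Field F] {u : Fin 3 → F} (hu : u ≠ 0) (c : Fin 2 → F) :
    stab u c ≠ ⊤ := fun h => by
  obtain ⟨A, hA⟩ := exists_mulVec_eq hu (fun _ : Fin 2 => (1 : F))
  have : (⟨A, 1⟩ : MatrixExt F) ∈ stab u c := h ▸ Subgroup.mem_top _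
  rw [mem_stab, hA] at this
  simpa using congrFun this 0

lemma exists_mem_stab {F : Type*} [Field F] (two : (2 : F) ≠ 0) {x : MatrixExt F} (hx : x.lin ≠ 1)
    (y : MatrixExt F) : ∃ (P : ℙ F (Fin 3 → F)) (c : Fin 2 → F),
      x ∈ stab P.rep c ∧ y ∈ stab P.rep c := by
  obtain ⟨s, hs⟩ := isUnit_one_sub two hx
  let T := (↑s⁻¹ : Matrix (Fin 2) (Fin 2) F) * x.trans
  have hT : x.trans = T - mat x.lin * T := by
    have h : (1 - mat x.lin) * T = x.trans := by
      rw [← hs, ← Matrix.mul_assoc, Units.mul_inv, Matrix.one_mul]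
    rw [← h, Matrix.sub_mul, Matrix.one_mul]
  obtain ⟨u, hu, hyu⟩ := exists_mulVec_eq_zero (y.trans - (T - mat y.lin * T))
  obtain ⟨a, ha⟩ := Projectivization.exists_smul_eq_mk_rep F u hu
  refine ⟨Projectivization.mk F u hu, T *ᵥ (Projectivization.mk F u hu).rep, ?_, ?_⟩
  · rw [mem_stab_mulVec, hT, sub_self, Matrix.zero_mulVec]
  · rw [mem_stab_mulVec, ← ha, Units.smul_def, Matrix.mulVec_smul, hyu, smul_zero]

lemma stab_injective {F : Type*} [Field F] (two : (2 : F) ≠ 0) :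
    Function.Injective fun i : ℙ F (Fin 3 → F) × (Fin 2 → F) => stab i.1.rep i.2 := by
  rintro ⟨P, c⟩ ⟨Q, d⟩ h
  simp only at h
  obtain ⟨W, R, -, hWu, hW⟩ := exists_matrix_ker_eq P.rep_nonzero
  have h1 : (⟨W, 1⟩ : MatrixExt F) ∈ stab Q.rep d := by
    rw [← h, mem_stab, hWu, mat_one, Matrix.one_mulVec, zero_add]
  obtain ⟨a, ha⟩ := hW Q.rep (by simpa [mem_stab] using h1)
  have hPQ : P = Q := by
    rw [← P.mk_rep, ← Q.mk_rep]
    exact ((Projectivization.mk_eq_mk_iff' _ _ _ _ _).2 ⟨a, ha⟩).symm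
  subst hPQ
  obtain ⟨T, hT⟩ := exists_mulVec_eq P.rep_nonzero ((2 : F) • c)
  have h2 : (⟨T, torus (-1)⟩ : MatrixExt F) ∈ stab P.rep d := by
    rw [← h, mem_stab, mat_torus_neg_one, hT, two_smul, Matrix.neg_mulVec, Matrix.one_mulVec,
      add_neg_cancel_right]
  rw [mem_stab, mat_torus_neg_one, hT, Matrix.neg_mulVec, Matrix.one_mulVec, add_neg_eq_iff_eq_add,
    ← two_smul F d] at h2
  rw [smul_right_injective _ two h2]

/-- No `stab u c` with `u ≠ 0` contains this pair. -/
lemma exists_pair_notMem_stab (F : Type*) [Field F] : ∃ x y : MatrixExt F,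
    ∀ u ≠ 0, ∀ c, x ∈ stab u c → y ∉ stab u c := by
  refine ⟨⟨!![1, 0, 0; 0, 1, 0], 1⟩, ⟨!![0, 0, 1; 0, 0, 0], 1⟩, fun u hu c hx hy => hu ?_⟩
  simp only [mem_stab, mat_one, Matrix.one_mulVec, add_eq_right] at hx hy
  have h0 := congrFun hx 0
  have h1 := congrFun hx 1
  have h2 := congrFun hy 0
  simp [Matrix.mulVec, dotProduct, Fin.sum_univ_three] at h0 h1 h2
  ext i
  fin_cases i <;> simp [h0, h1, h2]

section Covering

open Classical in
/-- The stabilizers of points together with the matrix part. -/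
noncomputable def stabCovering (F : Type*) [Field F] [Finite F] : Finset (Subgroup (MatrixExt F)) :=
  insert linHom.ker (Set.finite_range
    fun i : ℙ F (Fin 3 → F) × (Fin 2 → F) => stab i.1.rep i.2).toFinset

lemma isTwoCovering_stabCovering {F : Type*} [Field F] [Finite F] (two : (2 : F) ≠ 0) :
    IsTwoCovering (stabCovering F) := by
  classical
  constructor
  · intro H hH
    rw [stabCovering, Finset.mem_insert, Set.Finite.mem_toFinset] at hH
    rcases hH with rfl | ⟨i, rfl⟩
    · intro h
      have h1 : (⟨0, weyl⟩ : MatrixExt F) ∈ (linHom : MatrixExt F →* _).ker :=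
        h ▸ Subgroup.mem_top _
      have h2 : (weyl : monomialSL F) = 1 := MonoidHom.mem_ker.1 h1
      simpa [mat_weyl] using congrFun (congrFun (congrArg mat h2) 0) 0
    · exact stab_ne_top i.1.rep_nonzero _
  · intro x y
    by_cases hx : x.lin = 1
    · by_cases hy : y.lin = 1
      · exact ⟨linHom.ker, by simp [stabCovering], MonoidHom.mem_ker.2 hx, MonoidHom.mem_ker.2 hy⟩
      · obtain ⟨P, c, h1, h2⟩ := exists_mem_stab two hy x
        exact ⟨_, by simp [stabCovering], h2, h1⟩
    · obtain ⟨P, c, h1, h2⟩ := exists_mem_stab two hx y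
      exact ⟨_, by simp [stabCovering], h1, h2⟩

lemma card_index : Nat.card (ℙ (ZMod p) (Fin 3 → ZMod p) × (Fin 2 → ZMod p))
    = p ^ 2 + p ^ 3 + p ^ 4 := by
  rw [Nat.card_prod, Projectivization.card_of_finrank (n := 3) _ _ (by simp)]
  simp [Finset.sum_range_succ, Nat.card_eq_fintype_card, ZMod.card]
  ring

lemma sigma2_eq (two : (2 : ZMod p) ≠ 0) (three : (3 : ZMod p) ≠ 0) :
    sigma2 (MatrixExt (ZMod p)) = 1 + p ^ 2 + p ^ 3 + p ^ 4 := by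
  classical
  have hr : (Set.range fun i : ℙ (ZMod p) (Fin 3 → ZMod p) × (Fin 2 → ZMod p) =>
      stab i.1.rep i.2).ncard = p ^ 2 + p ^ 3 + p ^ 4 := by
    rw [← card_index, ← Nat.card_coe_set_eq, Nat.card_range_of_injective (stab_injective two)]
  have lower : ∀ 𝒞 : Finset (Subgroup (MatrixExt (ZMod p))), IsTwoCovering 𝒞 →
      1 + p ^ 2 + p ^ 3 + p ^ 4 ≤ 𝒞.card := by
    rintro 𝒞 ⟨hproper, hcov⟩
    obtain ⟨x, y, hxy⟩ := exists_pair_notMem_stab (ZMod p)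
    obtain ⟨K, hK, hxK, hyK⟩ := hcov x y
    have hKr : K ∉ (Set.range fun i : ℙ (ZMod p) (Fin 3 → ZMod p) × (Fin 2 → ZMod p) =>
        stab i.1.rep i.2) := by
      rintro ⟨i, rfl⟩
      exact hxy _ i.1.rep_nonzero _ hxK hyK
    have hsub : insert K (Set.range fun i : ℙ (ZMod p) (Fin 3 → ZMod p) × (Fin 2 → ZMod p) =>
        stab i.1.rep i.2) ⊆ (𝒞 : Set (Subgroup (MatrixExt (ZMod p)))) := by
      rintro H (rfl | ⟨i, rfl⟩)
      · exact hK
      · obtain ⟨x, y, hxy⟩ := exists_pair two three i.1.rep_nonzero i.2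
        obtain ⟨K, hK, hx, hy⟩ := hcov x y
        rw [hxy K (hproper K hK) hx hy] at hK
        exact hK
    have := Set.ncard_le_ncard hsub 𝒞.finite_toSet
    rw [Set.ncard_insert_of_notMem hKr, hr, Set.ncard_coe_finset] at this
    omega
  have hc := isTwoCovering_stabCovering two
  refine le_antisymm ?_ ?_
  · refine hc.sigma2_le.trans ?_
    refine (Finset.card_insert_le _ _).trans ?_
    rw [← Set.ncard_eq_toFinset_card, hr]
    omega
  · obtain ⟨𝒞, h𝒞, hcard⟩ := Nat.sInf_mem
      (s := {n | ∃ 𝒞 : Finset (Subgroup (MatrixExt (ZMod p))), IsTwoCovering 𝒞 ∧ 𝒞.card = n})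
      ⟨_, _, hc, rfl⟩
    rw [sigma2, ← hcard]
    exact lower 𝒞 h𝒞

end Covering

end MatrixExt

/-- There are infinitely many even positive integers `n` which are the 2-covering
number of some finite solvable group `G` with `d(G) ≥ 3` (i.e. `G` is not generated
by two elements). -/
theorem infinite_even_sigma2_of_solvable :
    {n : ℕ | Even n ∧ 0 < n ∧
      ∃ (G : Type) (_ : Group G), Finite G ∧ IsSolvable G ∧
        (∀ x y : G, Subgroup.closure {x, y} ≠ ⊤) ∧
        sigma2 G = n}.Infinite := by
  refine Set.infinite_of_forall_exists_gt fun n => ?_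
  obtain ⟨p, hnp, hp⟩ := Nat.exists_infinite_primes (n + 5)
  have : Fact p.Prime := ⟨hp⟩
  have ne_zero : ∀ k : ℕ, 0 < k → k < 5 → (k : ZMod p) ≠ 0 := fun k hk hk5 h => by
    have := Nat.le_of_dvd hk ((ZMod.natCast_eq_zero_iff k p).1 h)
    omega
  have two : (2 : ZMod p) ≠ 0 := by exact_mod_cast ne_zero 2 (by norm_num) (by norm_num)
  have three : (3 : ZMod p) ≠ 0 := by exact_mod_cast ne_zero 3 (by norm_num) (by norm_num)
  have hodd : Odd p := hp.odd_of_ne_two (by omega)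
  refine ⟨1 + p ^ 2 + p ^ 3 + p ^ 4, ⟨?_, by omega, MatrixExt (ZMod p), inferInstance,
    inferInstance, MatrixExt.isSolvable two,
    (MatrixExt.isTwoCovering_stabCovering two).closure_pair_ne_top,
    MatrixExt.sigma2_eq two three⟩, ?_⟩
  · exact ((odd_one.add_odd hodd.pow).add_odd hodd.pow).add_odd hodd.pow
  · nlinarith [Nat.zero_le (p ^ 3), Nat.zero_le (p ^ 4)]
end

section
/- There exists a finite solvable group G with d(G) ≥ 3 such that σ₂(G) ≠ r^{2t} + r^t + 1 for every prime r and every positive integer t. (This disproves the conjecture of Gagola and Kirtland that σ₂(G) always has the form p^{2t} + p^t + 1 for solvable G with d(G) ≥ 3; indeed r^{2t} + r^t + 1 is odd for every prime r and every t ≥ 1, while σ₂(G) = 1 + p² + p³ + p⁴ is even for the group G constructed for an odd prime p.) -/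
/-- The affine group of maps `X ↦ ρ(h) X + A` on `2 × 3` matrices over `𝔽₃`, where `h` runs over
the quaternion group of order 8. It is the semidirect product of three copies of the natural
module `𝔽₃²` by the quaternion group. -/
@[ext]
structure QuaternionAffine where
  /-- The linear part. -/
  rot : QuaternionGroup 2
  /-- The translation part. -/
  trans : Matrix (Fin 2) (Fin 3) (ZMod 3)

namespace QuaternionAffine

open Matrix QuaternionGroup
open scoped LinearAlgebra.Projectivization

/-- The faithful irreducible representation of the quaternion group of order 8 on `𝔽₃²`. -/
def quaternionRep : QuaternionGroup 2 →* Matrix (Fin 2) (Fin 2) (ZMod 3) where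
  toFun
    | a k => !![0, -1; 1, 0] ^ k.val
    | xa k => !![1, 1; 1, -1] * !![0, -1; 1, 0] ^ k.val
  map_one' := by decide
  map_mul' := by
    rintro (i | i) (j | j) <;> revert i j <;> decide

instance : Mul QuaternionAffine :=
  ⟨fun g g' => ⟨g.rot * g'.rot, quaternionRep g.rot * g'.trans + g.trans⟩⟩

instance : One QuaternionAffine := ⟨⟨1, 0⟩⟩

instance : Inv QuaternionAffine := ⟨fun g => ⟨g.rot⁻¹, -(quaternionRep g.rot⁻¹ * g.trans)⟩⟩

@[simp] lemma mul_rot (g g' : QuaternionAffine) : (g * g').rot = g.rot * g'.rot := rfl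

@[simp] lemma mul_trans (g g' : QuaternionAffine) :
    (g * g').trans = quaternionRep g.rot * g'.trans + g.trans := rfl

@[simp] lemma one_rot : (1 : QuaternionAffine).rot = 1 := rfl

@[simp] lemma one_trans : (1 : QuaternionAffine).trans = 0 := rfl

@[simp] lemma inv_rot (g : QuaternionAffine) : g⁻¹.rot = g.rot⁻¹ := rfl

@[simp] lemma inv_trans (g : QuaternionAffine) :
    g⁻¹.trans = -(quaternionRep g.rot⁻¹ * g.trans) := rfl

lemma rep_inv_mul_rep (h : QuaternionGroup 2) : quaternionRep h⁻¹ * quaternionRep h = 1 := by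
  rw [← map_mul, inv_mul_cancel, map_one]

lemma rep_mul_rep_inv (h : QuaternionGroup 2) : quaternionRep h * quaternionRep h⁻¹ = 1 := by
  rw [← map_mul, mul_inv_cancel, map_one]

instance : Group QuaternionAffine :=
  Group.ofLeftAxioms
    (fun g g' g'' => by
      ext1 <;> simp [mul_assoc, Matrix.mul_assoc, Matrix.mul_add, add_assoc])
    (fun g => by ext1 <;> simp)
    (fun g => by ext1 <;> simp)

instance : Finite QuaternionAffine :=
  Finite.of_injective (fun g => (g.rot, g.trans)) fun g g' h => by
    simp only [Prod.mk.injEq] at h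
    exact QuaternionAffine.ext h.1 h.2

/-- The projection to the linear part. -/
def rotHom : QuaternionAffine →* QuaternionGroup 2 where
  toFun := rot
  map_one' := rfl
  map_mul' _ _ := rfl

@[simp] lemma rotHom_apply (g : QuaternionAffine) : rotHom g = g.rot := rfl

instance : Group.IsSolvable QuaternionAffine := by
  have hQ : IsPGroup 2 (QuaternionGroup 2) :=
    IsPGroup.of_card (n := 3) (by rw [Nat.card_eq_fintype_card, QuaternionGroup.card]; norm_num)
  have := hQ.isNilpotent
  have : Group.IsSolvable (rotHom.ker) := Group.isSolvable_of_comm fun g g' => by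
    have hg : g.1.rot = 1 := g.2
    have hg' : g'.1.rot = 1 := g'.2
    ext1
    ext1 <;> simp [hg, hg', add_comm]
  exact Group.isSolvable_of_ker_le_range rotHom.ker.subtype rotHom (by simp)

/-- The stabilizer of `c` in the affine action `x ↦ ρ(h) x + A u` on `𝔽₃²`. -/
def stab (u : Fin 3 → ZMod 3) (c : Fin 2 → ZMod 3) : Subgroup QuaternionAffine where
  carrier := {g | quaternionRep g.rot *ᵥ c + g.trans *ᵥ u = c}
  one_mem' := by
    rw [Set.mem_ofPred_eq, one_rot, map_one, one_mulVec, one_trans, zero_mulVec, add_zero]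
  mul_mem' {g g'} hg hg' := by
    simp only [Set.mem_ofPred_eq] at *
    calc _ = quaternionRep g.rot *ᵥ (quaternionRep g'.rot *ᵥ c + g'.trans *ᵥ u)
            + g.trans *ᵥ u := by
          simp only [mul_rot, mul_trans, map_mul, Matrix.add_mulVec, Matrix.mulVec_add,
            Matrix.mulVec_mulVec, add_assoc]
      _ = c := by rw [hg', hg]
  inv_mem' {g} hg := by
    simp only [Set.mem_ofPred_eq] at *
    have := congrArg (quaternionRep g.rot⁻¹ *ᵥ ·) hg
    simp only [Matrix.mulVec_add, Matrix.mulVec_mulVec, rep_inv_mul_rep, one_mulVec] at this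
    simp only [inv_rot, inv_trans, Matrix.neg_mulVec]
    rw [← this]
    abel

lemma mem_stab {u : Fin 3 → ZMod 3} {c : Fin 2 → ZMod 3} {g : QuaternionAffine} :
    g ∈ stab u c ↔ quaternionRep g.rot *ᵥ c + g.trans *ᵥ u = c := Iff.rfl

lemma isUnit_one_sub_rep {h : QuaternionGroup 2} (hh : h ≠ 1) :
    IsUnit (1 - quaternionRep h) := by
  have key : ∀ h : QuaternionGroup 2, h ≠ 1 → (1 - quaternionRep h).det ≠ 0 := by
    rintro (i | i) <;> simp only [Matrix.det_fin_two] <;> revert i <;> decide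
  exact (Matrix.isUnit_iff_isUnit_det _).2 (key h hh).isUnit

lemma exists_mulVec_eq {u : Fin 3 → ZMod 3} (hu : u ≠ 0) (c : Fin 2 → ZMod 3) :
    ∃ B : Matrix (Fin 2) (Fin 3) (ZMod 3), B *ᵥ u = c := by
  obtain ⟨k, hk⟩ := Function.ne_iff.1 hu
  refine ⟨vecMulVec c (Pi.single k (u k)⁻¹), ?_⟩
  rw [vecMulVec_mulVec]
  ext i
  simp [inv_mul_cancel₀ hk]

lemma exists_mulVec_eq_zero_iff_mem_span {u : Fin 3 → ZMod 3} (hu : u ≠ 0) :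
    ∃ A : Matrix (Fin 2) (Fin 3) (ZMod 3), ∀ v, A *ᵥ v = 0 ↔ ∃ l : ZMod 3, l • u = v := by
  have hrank : Module.finrank (ZMod 3) ((Fin 3 → ZMod 3) ⧸ Submodule.span (ZMod 3) {u}) =
      Module.finrank (ZMod 3) (Fin 2 → ZMod 3) := by
    have := Submodule.finrank_quotient_add_finrank (Submodule.span (ZMod 3) {u})
    rw [finrank_span_singleton hu] at this
    simp at this ⊢
    omega
  let e := LinearEquiv.ofFinrankEq _ _ hrank
  refine ⟨LinearMap.toMatrix' (e.toLinearMap ∘ₗ Submodule.mkQ _), fun v => ?_⟩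
  rw [LinearMap.toMatrix'_mulVec]
  simp [Submodule.mem_span_singleton]

lemma stab_ne_top {u : Fin 3 → ZMod 3} (hu : u ≠ 0) (c : Fin 2 → ZMod 3) : stab u c ≠ ⊤ := by
  intro h
  obtain ⟨B, hB⟩ := exists_mulVec_eq hu 1
  have : (⟨1, B⟩ : QuaternionAffine) ∈ stab u c := h ▸ Subgroup.mem_top _
  rw [mem_stab] at this
  simp [hB] at this

lemma exists_pair_mem_stab_iff {u : Fin 3 → ZMod 3} (hu : u ≠ 0) (c : Fin 2 → ZMod 3) :
    ∃ x y : QuaternionAffine, x.rot = a 1 ∧ y.rot = xa 0 ∧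
      ∀ v d, x ∈ stab v d → y ∈ stab v d → ∃ l : ZMod 3, l • u = v ∧ l • c = d := by
  obtain ⟨A, hA⟩ := exists_mulVec_eq_zero_iff_mem_span hu
  obtain ⟨B, hB⟩ := exists_mulVec_eq hu c
  refine ⟨⟨a 1, (1 - quaternionRep (a 1)) * B⟩, ⟨xa 0, A + (1 - quaternionRep (xa 0)) * B⟩,
    rfl, rfl, fun v d hx hy => ?_⟩
  simp only [mem_stab, Matrix.add_mulVec, ← Matrix.mulVec_mulVec] at hx hy
  have hd : B *ᵥ v = d := by
    apply Matrix.mulVec_injective_of_isUnit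
      (isUnit_one_sub_rep (show (a 1 : QuaternionGroup 2) ≠ 1 by decide))
    rw [Matrix.sub_mulVec _ _ d, one_mulVec]
    exact eq_sub_of_add_eq' hx
  rw [hd, Matrix.sub_mulVec, one_mulVec] at hy
  obtain ⟨l, rfl⟩ := (hA v).1 (by linear_combination (exp := 1) hy)
  exact ⟨l, rfl, by rw [← hd, Matrix.mulVec_smul, hB]⟩

section Translations

variable (K : Subgroup QuaternionAffine)

/-- The translations contained in a subgroup. -/
def translations : Submodule (ZMod 3) (Matrix (Fin 2) (Fin 3) (ZMod 3)) :=
  AddSubgroup.toZModSubmodule 3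
    { carrier := {A | (⟨1, A⟩ : QuaternionAffine) ∈ K}
      zero_mem' := K.one_mem
      add_mem' := fun {A B} hA hB => by
        have := K.mul_mem hB hA
        rwa [show (⟨1, B⟩ * ⟨1, A⟩ : QuaternionAffine) = ⟨1, A + B⟩ by ext1 <;> simp] at this
      neg_mem' := fun {A} hA => by
        have := K.inv_mem hA
        rwa [show (⟨1, A⟩⁻¹ : QuaternionAffine) = ⟨1, -A⟩ by ext1 <;> simp] at this }

variable {K}

lemma mem_translations {A : Matrix (Fin 2) (Fin 3) (ZMod 3)} :
    A ∈ translations K ↔ (⟨1, A⟩ : QuaternionAffine) ∈ K := Iff.rfl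

lemma sub_mem_translations {g g' : QuaternionAffine} (hg : g ∈ K) (hg' : g' ∈ K)
    (h : g.rot = g'.rot) : g.trans - g'.trans ∈ translations K := by
  rw [mem_translations]
  convert K.mul_mem hg (K.inv_mem hg') using 1
  ext1
  · simp [h]
  · simp [h, ← Matrix.mul_assoc, rep_mul_rep_inv, sub_eq_neg_add]

lemma exists_mem_rot_eq {x y : QuaternionAffine} (hx : x ∈ K) (hy : y ∈ K)
    (hxr : x.rot = a 1) (hyr : y.rot = xa 0) (h : QuaternionGroup 2) :
    ∃ g ∈ K, g.rot = h := by
  have ha (k : ZMod (2 * 2)) : rotHom (x ^ k.val) = a k := by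
    rw [map_pow, rotHom_apply, hxr]
    revert k
    decide
  cases h with
  | a k => exact ⟨x ^ k.val, K.pow_mem hx _, ha k⟩
  | xa k =>
    refine ⟨y * x ^ k.val, K.mul_mem hy (K.pow_mem hx _), ?_⟩
    rw [mul_rot, hyr, ← rotHom_apply, ha]
    simp

lemma span_range_quaternionRep :
    Submodule.span (ZMod 3) (Set.range quaternionRep) = ⊤ := by
  refine Submodule.eq_top_iff'.2 fun X => ?_
  have hX : X = -(X 0 0 + X 1 1) • quaternionRep (a 0) + (X 0 1 - X 1 0) • quaternionRep (a 1) +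
      (X 0 0 + X 0 1 + X 1 0 - X 1 1) • quaternionRep (xa 0) +
      (X 0 0 - X 0 1 - X 1 0 - X 1 1) • quaternionRep (xa 1) := by
    have key : ∀ x y z w : ZMod 3, !![x, y; z, w] = -(x + w) • quaternionRep (a 0) +
        (y - z) • quaternionRep (a 1) + (x + y + z - w) • quaternionRep (xa 0) +
        (x - y - z - w) • quaternionRep (xa 1) := by
      decide
    conv_lhs => rw [Matrix.eta_fin_two X]
    exact key _ _ _ _
  have hmem (h : QuaternionGroup 2) :
      quaternionRep h ∈ Submodule.span (ZMod 3) (Set.range quaternionRep) :=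
    Submodule.subset_span ⟨h, rfl⟩
  rw [hX]
  exact add_mem (add_mem (add_mem (Submodule.smul_mem _ _ (hmem _))
    (Submodule.smul_mem _ _ (hmem _))) (Submodule.smul_mem _ _ (hmem _)))
    (Submodule.smul_mem _ _ (hmem _))

lemma mul_mem_translations (hK : ∀ h, ∃ g ∈ K, g.rot = h)
    {A : Matrix (Fin 2) (Fin 3) (ZMod 3)} (hA : A ∈ translations K)
    (X : Matrix (Fin 2) (Fin 2) (ZMod 3)) : X * A ∈ translations K := by
  suffices h : Submodule.span (ZMod 3) (Set.range quaternionRep) ≤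
      (translations K).comap (mulRightLinearMap (Fin 2) (ZMod 3) A) from
    h (span_range_quaternionRep ▸ Submodule.mem_top)
  rw [Submodule.span_le]
  rintro _ ⟨h, rfl⟩
  change quaternionRep h * A ∈ translations K
  obtain ⟨g, hg, rfl⟩ := hK h
  rw [mem_translations]
  convert K.mul_mem (K.mul_mem hg hA) (K.inv_mem hg) using 1
  ext1
  · simp
  · simp [← Matrix.mul_assoc, rep_mul_rep_inv]

lemma exists_mulVec_eq_zero_of_translations_ne_top (hK : ∀ h, ∃ g ∈ K, g.rot = h)
    (hT : translations K ≠ ⊤) :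
    ∃ u : Fin 3 → ZMod 3, u ≠ 0 ∧ ∀ A ∈ translations K, A *ᵥ u = 0 := by
  let R : Submodule (ZMod 3) (Fin 3 → ZMod 3) :=
    (translations K).comap (vecMulVecBilin (ZMod 3) (ZMod 3) (Pi.single 0 1))
  have mem_R {r} : r ∈ R ↔ vecMulVec (Pi.single 0 1) r ∈ translations K := Iff.rfl
  have hR : R < ⊤ := by
    refine lt_top_iff_ne_top.2 fun hR => hT (Submodule.eq_top_iff'.2 fun A => ?_)
    have hA : A = ∑ i, vecMulVec (Pi.single i (1 : ZMod 3)) (Pi.single (0 : Fin 2) (1 : ZMod 3)) *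
        vecMulVec (Pi.single (0 : Fin 2) 1) (A i) := by
      ext i j
      fin_cases i <;> simp [vecMulVec_mul_vecMulVec, vecMulVec_apply]
    rw [hA]
    exact Submodule.sum_mem _ fun i _ =>
      mul_mem_translations hK (mem_R.1 (hR ▸ Submodule.mem_top)) _
  obtain ⟨f, hf, hRf⟩ := Submodule.exists_le_ker_of_lt_top R hR
  have hfu (r : Fin 3 → ZMod 3) : f r = r ⬝ᵥ fun k => f (Pi.single k 1) := by
    conv_lhs => rw [pi_eq_sum_univ' r]
    simp [dotProduct]
  refine ⟨fun k => f (Pi.single k 1), fun h => hf ?_, fun A hA => ?_⟩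
  · exact LinearMap.ext fun r => by rw [hfu, h]; simp
  · ext i
    rw [mulVec, ← hfu]
    apply hRf
    rw [mem_R]
    convert mul_mem_translations hK hA (vecMulVec (Pi.single 0 1) (Pi.single i 1)) using 1
    rw [vecMulVec_mul, single_one_vecMul]
    rfl

/-- A proper subgroup projecting onto the quaternion group fixes a point of one of the affine
actions on `𝔽₃²`. -/
lemma exists_le_stab (hK : ∀ h, ∃ g ∈ K, g.rot = h) (hK' : K ≠ ⊤) :
    ∃ u c, u ≠ 0 ∧ K ≤ stab u c := by
  have hT : translations K ≠ ⊤ := by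
    refine fun hT => hK' ((Subgroup.eq_top_iff' K).2 fun g => ?_)
    obtain ⟨g', hg', h⟩ := hK g.rot
    have hm : g.trans - g'.trans ∈ translations K := hT ▸ Submodule.mem_top
    convert K.mul_mem (mem_translations.1 hm) hg' using 1
    ext1 <;> simp [h]
  obtain ⟨u, hu, hTu⟩ := exists_mulVec_eq_zero_of_translations_ne_top hK hT
  obtain ⟨z, hz, hzr⟩ := hK (a 2)
  refine ⟨u, -(z.trans *ᵥ u), hu, fun g hg => ?_⟩
  have hcomm : (g * z).rot = (z * g).rot := by
    have key : ∀ h : QuaternionGroup 2, h * a 2 = a 2 * h := by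
      rintro (i | i) <;> revert i <;> decide
    rw [mul_rot, mul_rot, hzr, key]
  have h := hTu _ (sub_mem_translations (K.mul_mem hg hz) (K.mul_mem hz hg) hcomm)
  have hneg : quaternionRep (a 2) = -1 := by decide
  have h3 : (3 : Fin 2 → ZMod 3) = 0 := by decide
  simp only [mul_trans, hzr, hneg, Matrix.sub_mulVec, Matrix.add_mulVec, Matrix.neg_mul,
    Matrix.one_mul, Matrix.neg_mulVec, ← Matrix.mulVec_mulVec] at h
  rw [mem_stab, Matrix.mulVec_neg]
  linear_combination (g.trans *ᵥ u) * h3 - h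

end Translations

/-- The kernel of the projection to the quaternion group together with the stabilizers of points
in the affine actions on `𝔽₃²`. -/
noncomputable def coveringSubgroup :
    Option (ℙ (ZMod 3) (Fin 3 → ZMod 3) × (Fin 2 → ZMod 3)) → Subgroup QuaternionAffine
  | none => rotHom.ker
  | some (p, c) => stab p.rep c

lemma coveringSubgroup_ne_top (i) : coveringSubgroup i ≠ ⊤ := by
  rcases i with _ | ⟨p, c⟩
  · intro h
    have : (⟨a 1, 0⟩ : QuaternionAffine) ∈ coveringSubgroup none := by
      rw [h]
      exact Subgroup.mem_top _
    exact absurd (MonoidHom.mem_ker.1 this) (by decide)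
  · exact stab_ne_top p.rep_nonzero c

lemma exists_stab_of_rot_ne_one {x : QuaternionAffine} (hx : x.rot ≠ 1) (y : QuaternionAffine) :
    ∃ (p : ℙ (ZMod 3) (Fin 3 → ZMod 3)) (c : Fin 2 → ZMod 3),
      x ∈ stab p.rep c ∧ y ∈ stab p.rep c := by
  obtain ⟨X, hX⟩ := (isUnit_one_sub_rep hx).exists_right_inv
  let T := y.trans - (1 - quaternionRep y.rot) * X * x.trans
  obtain ⟨p, hTp⟩ : ∃ p : ℙ (ZMod 3) (Fin 3 → ZMod 3), T *ᵥ p.rep = 0 := by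
    have := LinearMap.ker_ne_bot_of_finrank_lt (f := T.mulVecLin) (by simp)
    obtain ⟨u, hTu, hu⟩ := Submodule.exists_mem_ne_zero_of_ne_bot this
    obtain ⟨l, hl⟩ := Projectivization.exists_smul_eq_mk_rep (ZMod 3) u hu
    refine ⟨Projectivization.mk (ZMod 3) u hu, ?_⟩
    rw [← hl, Matrix.mulVec_smul, show T *ᵥ u = 0 from hTu, smul_zero]
  refine ⟨p, (X * x.trans) *ᵥ p.rep, ?_, ?_⟩
  · have := congrArg (fun Y => (Y * x.trans) *ᵥ p.rep) hX
    simp only [Matrix.sub_mul, Matrix.one_mul, Matrix.sub_mulVec, Matrix.mul_assoc] at this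
    rw [mem_stab, Matrix.mulVec_mulVec]
    linear_combination -this
  · simp only [T, Matrix.sub_mul, Matrix.one_mul, Matrix.sub_mulVec, Matrix.mul_assoc] at hTp
    rw [mem_stab, Matrix.mulVec_mulVec]
    linear_combination hTp

lemma exists_mem_coveringSubgroup (x y : QuaternionAffine) :
    ∃ i, x ∈ coveringSubgroup i ∧ y ∈ coveringSubgroup i := by
  by_cases hx : x.rot = 1
  · by_cases hy : y.rot = 1
    · exact ⟨none, hx, hy⟩
    · obtain ⟨p, c, h⟩ := exists_stab_of_rot_ne_one hy x
      exact ⟨some (p, c), h.2, h.1⟩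
  · obtain ⟨p, c, h⟩ := exists_stab_of_rot_ne_one hx y
    exact ⟨some (p, c), h⟩

/-- There are as many pairs as subgroups `coveringSubgroup i` such that no proper subgroup contains
two of these pairs. -/
lemma exists_pairs :
    ∃ x y : Option (ℙ (ZMod 3) (Fin 3 → ZMod 3) × (Fin 2 → ZMod 3)) → QuaternionAffine,
      ∀ i j, ∀ K : Subgroup QuaternionAffine, K ≠ ⊤ →
        x i ∈ K → y i ∈ K → x j ∈ K → y j ∈ K → i = j := by
  choose x y hx hy hxy using fun q : ℙ (ZMod 3) (Fin 3 → ZMod 3) × (Fin 2 → ZMod 3) =>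
    exists_pair_mem_stab_iff q.1.rep_nonzero q.2
  have hnone (q) (K : Subgroup QuaternionAffine) (hK : K ≠ ⊤) (hxq : x q ∈ K) (hyq : y q ∈ K)
      (h₁ : (⟨1, !![1, 0, 0; 0, 1, 0]⟩ : QuaternionAffine) ∈ K)
      (h₂ : (⟨1, !![0, 0, 1; 0, 0, 0]⟩ : QuaternionAffine) ∈ K) : False := by
    obtain ⟨u, c, hu, hle⟩ := exists_le_stab (exists_mem_rot_eq hxq hyq (hx q) (hy q)) hK
    have h₁ := mem_stab.1 (hle h₁)
    have h₂ := mem_stab.1 (hle h₂)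
    simp only [map_one, one_mulVec, add_eq_left] at h₁ h₂
    have h0 := congrFun h₁ 0
    have h1 := congrFun h₁ 1
    have h2 := congrFun h₂ 0
    simp [Matrix.mulVec, dotProduct, Fin.sum_univ_three] at h0 h1 h2
    apply hu
    ext k
    fin_cases k <;> simp [h0, h1, h2]
  refine ⟨fun i => i.elim ⟨1, !![1, 0, 0; 0, 1, 0]⟩ x, fun i => i.elim ⟨1, !![0, 0, 1; 0, 0, 0]⟩ y,
    ?_⟩
  rintro (_ | q) (_ | r) K hK hi hi' hj hj'
  · rfl
  · exact (hnone r K hK hj hj' hi hi').elim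
  · exact (hnone q K hK hi hi' hj hj').elim
  · simp only [Option.elim_some] at hi hi' hj hj'
    obtain ⟨u, c, hu, hle⟩ := exists_le_stab (exists_mem_rot_eq hi hi' (hx q) (hy q)) hK
    obtain ⟨l, hlu, hlc⟩ := hxy q u c (hle hi) (hle hi')
    obtain ⟨m, hmu, hmc⟩ := hxy r u c (hle hj) (hle hj')
    have hl : l ≠ 0 := by rintro rfl; exact hu (by rw [← hlu, zero_smul])
    have hqr : q.1 = r.1 := by
      rw [← q.1.mk_rep, ← r.1.mk_rep, Projectivization.mk_eq_mk_iff']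
      exact ⟨l⁻¹ * m, by rw [mul_smul, hmu, ← hlu, inv_smul_smul₀ hl]⟩
    have hlm : l = m := by
      rw [← hqr, ← hlu] at hmu
      exact (smul_left_injective _ q.1.rep_nonzero hmu).symm
    subst hlm
    exact congrArg some (Prod.ext hqr (smul_right_injective _ hl (hlc.trans hmc.symm)))

lemma card_index :
    Nat.card (Option (ℙ (ZMod 3) (Fin 3 → ZMod 3) × (Fin 2 → ZMod 3))) = 118 := by
  rw [Finite.card_option, Nat.card_prod, Projectivization.card_of_finrank _ _
    (Module.finrank_fin_fun (ZMod 3) (n := 3))]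
  simp [Finset.sum_range_succ]

theorem sigma2_eq : sigma2 QuaternionAffine = 118 := by
  classical
  have := Fintype.ofFinite (Option (ℙ (ZMod 3) (Fin 3 → ZMod 3) × (Fin 2 → ZMod 3)))
  have hcov : IsTwoCovering (Finset.univ.image coveringSubgroup) := by
    refine ⟨fun H hH => ?_, fun x y => ?_⟩
    · obtain ⟨i, -, rfl⟩ := Finset.mem_image.1 hH
      exact coveringSubgroup_ne_top i
    · obtain ⟨i, hi⟩ := exists_mem_coveringSubgroup x y
      exact ⟨_, Finset.mem_image_of_mem _ (Finset.mem_univ i), hi⟩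
  rw [← card_index, Nat.card_eq_fintype_card]
  refine le_antisymm (le_trans (Nat.sInf_le ⟨_, hcov, rfl⟩) Finset.card_image_le) ?_
  refine le_csInf ⟨_, _, hcov, rfl⟩ ?_
  rintro _ ⟨𝒞, ⟨hne, h𝒞⟩, rfl⟩
  obtain ⟨x, y, hxy⟩ := exists_pairs
  choose K hK hxK hyK using fun i => h𝒞 (x i) (y i)
  refine Finset.card_le_card_of_injOn K (fun i _ => hK i) fun i _ j _ hij => ?_
  exact hxy i j (K i) (hne _ (hK i)) (hxK i) (hyK i) (hij ▸ hxK j) (hij ▸ hyK j)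

end QuaternionAffine

open QuaternionAffine in
/-- There exists a finite solvable group `G` with `d(G) ≥ 3` (i.e. `G` is not
generated by two elements) such that `σ₂(G) ≠ r^(2t) + r^t + 1` for every prime `r`
and every positive integer `t`.  This disproves the conjecture of Gagola and
Kirtland. -/
theorem exists_solvable_sigma2_ne_conjectured_form :
    ∃ (G : Type) (_ : Group G), Finite G ∧ IsSolvable G ∧
      (∀ x y : G, Subgroup.closure {x, y} ≠ ⊤) ∧
      ∀ (r t : ℕ), r.Prime → 1 ≤ t → sigma2 G ≠ r ^ (2 * t) + r ^ t + 1 := by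
  refine ⟨QuaternionAffine, inferInstance, inferInstance,
    inferInstanceAs (Group.IsSolvable QuaternionAffine), fun x y h => ?_,
    fun r t _ _ h => ?_⟩
  · obtain ⟨i, hx, hy⟩ := exists_mem_coveringSubgroup x y
    refine coveringSubgroup_ne_top i (top_le_iff.1 (h ▸ (Subgroup.closure_le _).2 ?_))
    rintro _ (rfl | rfl)
    exacts [hx, hy]
  · have heven := Nat.even_mul_succ_self (r ^ t)
    rw [sigma2_eq] at h
    have : r ^ (2 * t) + r ^ t = r ^ t * (r ^ t + 1) := by ring
    rw [← this] at heven
    obtain ⟨k, hk⟩ := heven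
    omega
end

section
/- Let H be a group acting by automorphisms on a (finite) abelian group A, let G = A ⋊ H be the corresponding semidirect product, and identify A and H with their canonical images in G. Let W be an H-invariant subgroup of A such that the induced action of H on the quotient A/W has no nonzero fixed points (i.e. the only H-fixed element of A/W is the identity coset). For v ∈ A, let H^v denote the conjugate of the subgroup H by v in G. Then for all v₁, v₂ ∈ A, the subgroups W·H^{v₁} and W·H^{v₂} of G (the subgroups generated by W together with H^{v₁}, respectively H^{v₂}) are equal if and only if v₁ − v₂ ∈ W. -/
/-- The subgroup `W·H^v` of the semidirect product `A ⋊ H`:  here `A` is an additive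
abelian group on which `H` acts via `φ`, `W` is an (`H`-invariant) subgroup of `A`,
`H^v` denotes the conjugate `{v⁻¹hv : h ∈ H}` of the canonical image of `H` by the
canonical image of `v ∈ A`, and `W·H^v` is the subgroup generated by (the canonical
images of) `W` and `H^v`. -/
def mulWHv {A : Type*} [AddCommGroup A] {H : Type*} [Group H]
    (φ : H →* MulAut (Multiplicative A)) (W : AddSubgroup A) (v : A) :
    Subgroup (Multiplicative A ⋊[φ] H) :=
  ((AddSubgroup.toSubgroup W).map SemidirectProduct.inl) ⊔
    (Subgroup.map
      (MulAut.conj ((SemidirectProduct.inl (Multiplicative.ofAdd v) : Multiplicative A ⋊[φ] H))⁻¹).toMonoidHom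
      (SemidirectProduct.inr : H →* Multiplicative A ⋊[φ] H).range)

open Multiplicative in
theorem map_inl_normal_of_invariant {A : Type*} [AddCommGroup A] {H : Type*} [Group H]
    (φ : H →* MulAut (Multiplicative A)) (W : AddSubgroup A)
    (hW : ∀ (h : H) (w : A), w ∈ W → (φ h (ofAdd w)).toAdd ∈ W) :
    ((AddSubgroup.toSubgroup W).map
      (SemidirectProduct.inl : Multiplicative A →* Multiplicative A ⋊[φ] H)).Normal where
  conj_mem := by
    rintro _ ⟨w, hw, rfl⟩ g
    refine ⟨φ g.right w, hW g.right w.toAdd hw, ?_⟩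
    ext <;> simp [mul_comm]

open Multiplicative in
theorem mem_mulWHv_iff {A : Type*} [AddCommGroup A] {H : Type*} [Group H]
    (φ : H →* MulAut (Multiplicative A)) (W : AddSubgroup A)
    (hW : ∀ (h : H) (w : A), w ∈ W → (φ h (ofAdd w)).toAdd ∈ W)
    (v : A) (g : Multiplicative A ⋊[φ] H) :
    g ∈ mulWHv φ W v ↔ g.left.toAdd + v - (φ g.right (ofAdd v)).toAdd ∈ W := by
  have := map_inl_normal_of_invariant φ W hW
  rw [mulWHv, Subgroup.mem_sup_of_normal_left]
  constructor
  · rintro ⟨_, ⟨w, hw, rfl⟩, _, ⟨_, ⟨h, rfl⟩, rfl⟩, rfl⟩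
    have hw' : w.toAdd ∈ W := hw
    convert hw' using 1
    simp
    abel
  · intro hg
    refine ⟨_, ⟨ofAdd (g.left.toAdd + v - (φ g.right (ofAdd v)).toAdd), hg, rfl⟩,
      _, ⟨_, ⟨g.right, rfl⟩, rfl⟩, ?_⟩
    ext
    · apply toAdd.injective
      simp [-ofAdd_add, -ofAdd_sub]
    · simp [-ofAdd_add, -ofAdd_sub]

/-- Let `H` act by automorphisms on a finite abelian group `A`, let `G = A ⋊ H`, and
let `W` be an `H`-invariant subgroup of `A` such that the induced action of `H` on
`A/W` has no nonzero fixed points.  Then for `v₁, v₂ ∈ A` the subgroups `W·H^{v₁}`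
and `W·H^{v₂}` of `G` coincide if and only if `v₁ − v₂ ∈ W`. -/
theorem mulWHv_eq_iff {A : Type*} [AddCommGroup A] [Finite A] {H : Type*} [Group H]
    (φ : H →* MulAut (Multiplicative A)) (W : AddSubgroup A)
    (hW : ∀ (h : H) (w : A), w ∈ W → (φ h (Multiplicative.ofAdd w)).toAdd ∈ W)
    (hfix : ∀ a : A, (∀ h : H, (φ h (Multiplicative.ofAdd a)).toAdd - a ∈ W) → a ∈ W)
    (v₁ v₂ : A) :
    mulWHv φ W v₁ = mulWHv φ W v₂ ↔ v₁ - v₂ ∈ W := by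
  have key (h : H) : (φ h (Multiplicative.ofAdd (v₁ - v₂))).toAdd =
      (φ h (Multiplicative.ofAdd v₁)).toAdd - (φ h (Multiplicative.ofAdd v₂)).toAdd := by
    simp
  constructor
  · intro heq
    refine hfix _ fun h => ?_
    have hmem : (⟨Multiplicative.ofAdd ((φ h (Multiplicative.ofAdd v₁)).toAdd - v₁), h⟩ :
        Multiplicative A ⋊[φ] H) ∈ mulWHv φ W v₁ := by
      rw [mem_mulWHv_iff φ W hW]
      simp only [toAdd_ofAdd, sub_add_cancel, sub_self, W.zero_mem]
    rw [heq, mem_mulWHv_iff φ W hW] at hmem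
    convert hmem using 1
    rw [key, toAdd_ofAdd]
    abel
  · intro hv
    ext g
    rw [mem_mulWHv_iff φ W hW, mem_mulWHv_iff φ W hW,
      ← W.add_mem_cancel_right (W.sub_mem (hW g.right _ hv) hv), key]
    abel_nf
end

section
/- Let ℓ be a prime, K = 𝔽_ℓ, H a finite group, and V a finite nontrivial irreducible K[H]-module (nontrivial meaning H does not act trivially on V). Let F = End_{K[H]}(V), q = |F|, and r = dim_F V. Set A = V^{r+1} and let G = A ⋊ H be the semidirect product. Then the number of subgroups of G of the form W·H^v, where W ranges over the maximal K[H]-submodules of A, v ranges over A, and H^v denotes the conjugate of H by v in G, is exactly q^r·(q^{r+1} − 1)/(q − 1) = (q^{2r+1} − q^r)/(q − 1). -/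
namespace SemidirectProduct

section Membership

variable {A : Type*} [AddCommGroup A] {H : Type*} [Group H]

/-- The elements `(a, h)` of `A ⋊ H` for which `a - (h • v - v)` lies in the `H`-stable
subgroup `W`. -/
def cosetSubgroup (φ : H →* MulAut (Multiplicative A)) (W : AddSubgroup A)
    (hW : ∀ h : H, ∀ a ∈ W, (φ h (.ofAdd a)).toAdd ∈ W) (v : A) :
    Subgroup (Multiplicative A ⋊[φ] H) where
  carrier := {g | g.left.toAdd - ((φ g.right (.ofAdd v)).toAdd - v) ∈ W}
  one_mem' := by simp
  mul_mem' := by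
    intro x y hx hy
    have key := W.add_mem hx (hW x.right _ hy)
    simp only [Set.mem_ofPred_eq, mul_left, mul_right, map_mul, MulAut.mul_apply, toAdd_mul,
      ofAdd_sub, map_div, toAdd_div, ofAdd_toAdd] at key ⊢
    convert key using 1
    abel
  inv_mem' := by
    intro x hx
    have key := W.neg_mem (hW x.right⁻¹ _ hx)
    simp only [Set.mem_ofPred_eq, inv_left, inv_right, map_inv, toAdd_inv,
      ofAdd_sub, map_div, toAdd_div, ofAdd_toAdd, MulAut.inv_apply_self] at key ⊢
    convert key using 1
    simp only [toAdd_ofAdd]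
    abel

theorem mem_mulWHv_iff (φ : H →* MulAut (Multiplicative A)) (W : AddSubgroup A)
    (hW : ∀ h : H, ∀ a ∈ W, (φ h (.ofAdd a)).toAdd ∈ W) (v : A)
    (g : Multiplicative A ⋊[φ] H) :
    g ∈ mulWHv φ W v ↔ g.left.toAdd - ((φ g.right (.ofAdd v)).toAdd - v) ∈ W := by
  constructor
  · have hle : mulWHv φ W v ≤ cosetSubgroup φ W hW v := by
      refine sup_le ?_ ?_
      · rintro _ ⟨a, ha, rfl⟩
        change _ ∈ W
        simpa using ha
      · rintro _ ⟨_, ⟨h, rfl⟩, rfl⟩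
        change _ ∈ W
        simp [← sub_eq_neg_add]
    exact fun hg => hle hg
  · intro hg
    have hdecomp : g = inl (.ofAdd (g.left.toAdd - ((φ g.right (.ofAdd v)).toAdd - v))) *
        MulAut.conj ((inl (.ofAdd v) : Multiplicative A ⋊[φ] H))⁻¹ (inr g.right) := by
      ext
      · simp [MulAut.conj_apply, -map_inv, -ofAdd_sub]
        abel
      · simp [MulAut.conj_apply, -map_inv, -ofAdd_sub]
    rw [hdecomp]
    exact mul_mem (Subgroup.mem_sup_left ⟨_, hg, rfl⟩)
      (Subgroup.mem_sup_right ⟨_, ⟨g.right, rfl⟩, rfl⟩)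

end Membership

end SemidirectProduct

theorem MonoidAlgebra.eq_zero_of_forall_of_smul_eq {k G V : Type*} [CommRing k] [Group G]
    [AddCommGroup V] [Module (MonoidAlgebra k G) V] [IsSimpleModule (MonoidAlgebra k G) V]
    (hnontriv : ∃ (g : G) (v : V), MonoidAlgebra.of k G g • v ≠ v) {y : V}
    (hy : ∀ g : G, MonoidAlgebra.of k G g • y = y) : y = 0 := by
  by_contra hne
  obtain ⟨h, v, hv⟩ := hnontriv
  obtain ⟨x, rfl⟩ := IsSimpleModule.toSpanSingleton_surjective (MonoidAlgebra k G) hne v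
  refine hv ?_
  clear hv
  simp only [LinearMap.toSpanSingleton_apply]
  induction x using MonoidAlgebra.induction_on with
  | of g => rw [hy, hy]
  | add a b ha hb => rw [add_smul, smul_add, ha, hb]
  | smul c a ha =>
    rw [← mul_smul, mul_smul_comm, ← smul_one_mul c (_ * _), mul_smul, mul_smul, ha,
      ← mul_smul, smul_one_mul]

theorem Nat.card_subtype_ne_zero (M : Type*) [Zero M] [Finite M] :
    Nat.card {x : M // x ≠ 0} = Nat.card M - 1 := by
  classical
  have := Fintype.ofFinite M
  simp [Nat.card_eq_fintype_card, Fintype.card_subtype_compl]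

section Coatoms

variable {R V : Type*} [Ring R] [AddCommGroup V] [Module R V] [IsSimpleModule R V]
  {ι : Type*}

theorem Submodule.exists_ker_eq_of_isCoatom [Finite ι] {W : Submodule R (ι → V)}
    (hW : IsCoatom W) : ∃ f : (ι → V) →ₗ[R] V, f ≠ 0 ∧ LinearMap.ker f = W := by
  classical
  have := Fintype.ofFinite ι
  have : IsSimpleModule R ((ι → V) ⧸ W) := isSimpleModule_iff_isCoatom.mpr hW
  obtain ⟨i, hi⟩ : ∃ i, W.mkQ ∘ₗ LinearMap.single R (fun _ => V) i ≠ 0 := by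
    by_contra! h
    have h0 : W.mkQ = 0 := LinearMap.pi_ext' fun i => by simpa using h i
    exact hW.1 (by simpa using congrArg LinearMap.ker h0)
  let e := LinearEquiv.ofBijective _ (LinearMap.bijective_of_ne_zero hi)
  have hker : LinearMap.ker (e.symm.toLinearMap ∘ₗ W.mkQ) = W := by
    rw [LinearEquiv.ker_comp, Submodule.ker_mkQ]
  exact ⟨_, fun h0 => hW.1 (by rw [← hker, h0, LinearMap.ker_zero]), hker⟩

theorem LinearMap.isCoatom_ker_of_ne_zero {M : Type*} [AddCommGroup M] [Module R M]
    {f : M →ₗ[R] V} (hf : f ≠ 0) : IsCoatom (LinearMap.ker f) := by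
  rw [← isSimpleModule_iff_isCoatom]
  exact IsSimpleModule.congr (f.quotKerEquivOfSurjective (LinearMap.surjective_of_ne_zero hf))

/-- The linear maps with the same kernel as a nonzero map to a simple module are its
composites with the nonzero endomorphisms of that module. -/
noncomputable def LinearMap.neZeroEndEquivKerEq {M : Type*} [AddCommGroup M] [Module R M]
    {f : M →ₗ[R] V} (hf : f ≠ 0) :
    {e : Module.End R V // e ≠ 0} ≃ {g : M →ₗ[R] V // LinearMap.ker g = LinearMap.ker f} := by
  have hsurj := LinearMap.surjective_of_ne_zero hf
  refine Equiv.ofBijective (fun e => ⟨e.1 ∘ₗ f, ?_⟩) ⟨?_, ?_⟩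
  · rw [LinearMap.ker_comp, LinearMap.ker_eq_bot.mpr (LinearMap.injective_of_ne_zero e.2)]
    rfl
  · intro e e' h
    exact Subtype.ext ((LinearMap.cancel_right hsurj).mp (congrArg Subtype.val h))
  · rintro ⟨g, hg⟩
    let e : Module.End R V := (LinearMap.ker f).liftQ g hg.ge ∘ₗ
      (f.quotKerEquivOfSurjective hsurj).symm.toLinearMap
    have he : e ∘ₗ f = g := by
      ext x
      have : (f.quotKerEquivOfSurjective hsurj).symm (f x) = Submodule.Quotient.mk x := by
        rw [LinearEquiv.symm_apply_eq]; rfl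
      simp [e, this]
    refine ⟨⟨e, ?_⟩, Subtype.ext he⟩
    rintro h0
    rw [h0, LinearMap.zero_comp] at he
    rw [← he, LinearMap.ker_zero] at hg
    exact hf (LinearMap.ker_eq_top.mp hg.symm)

theorem Submodule.card_isCoatom_pi_mul [Finite V] [Fintype ι] :
    Nat.card {W : Submodule R (ι → V) // IsCoatom W} * (Nat.card (Module.End R V) - 1) =
      Nat.card (Module.End R V) ^ Fintype.card ι - 1 := by
  classical
  have : Finite (Module.End R V) := .of_injective _ DFunLike.coe_injective
  have : Finite ((ι → V) →ₗ[R] V) := .of_injective _ DFunLike.coe_injective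
  have hhom : Nat.card ((ι → V) →ₗ[R] V) = Nat.card (Module.End R V) ^ Fintype.card ι := by
    rw [← Nat.card_congr (LinearMap.lsum R (fun _ : ι => V) ℕ (M := V)).toEquiv, Nat.card_fun,
      Nat.card_eq_fintype_card (α := ι)]
  let p : {f : (ι → V) →ₗ[R] V // f ≠ 0} → {W : Submodule R (ι → V) // IsCoatom W} :=
    fun f => ⟨LinearMap.ker f.1, LinearMap.isCoatom_ker_of_ne_zero f.2⟩
  have hfiber (W) : Nat.card {f // p f = W} = Nat.card (Module.End R V) - 1 := by
    obtain ⟨f, hf, hW⟩ := Submodule.exists_ker_eq_of_isCoatom W.2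
    rw [← Nat.card_subtype_ne_zero, Nat.card_congr (LinearMap.neZeroEndEquivKerEq hf)]
    refine Nat.card_congr ⟨fun g => ⟨g.1.1, (congrArg Subtype.val g.2).trans hW.symm⟩,
      fun g => ⟨⟨g.1, ?_⟩, Subtype.ext (g.2.trans hW)⟩, fun _ => rfl, fun _ => rfl⟩
    intro h0
    have := g.2
    rw [h0, LinearMap.ker_zero, hW] at this
    exact W.2.1 this.symm
  rw [← hhom, ← Nat.card_subtype_ne_zero ((ι → V) →ₗ[R] V), ← Nat.card_congr (Equiv.sigmaFiberEquiv p)]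
  have := Fintype.ofFinite {W : Submodule R (ι → V) // IsCoatom W}
  rw [Nat.card_sigma]
  simp [hfiber]

end Coatoms

/-- Let `ℓ` be a prime, `K = 𝔽_ℓ = ZMod ℓ`, `H` a finite group, `V` a finite
nontrivial irreducible `K[H]`-module, `F = End_{K[H]}(V)`, `q = |F|` and
`r = dim_F V`.  Set `A = V^(r+1)` and let `G = A ⋊ H` be the semidirect product for
the corresponding action `φ` of `H` on `A`.  Then the number of subgroups of `G` of
the form `W·H^v`, with `W` a maximal `K[H]`-submodule of `A` and `v ∈ A`, is exactly
`q^r·(q^(r+1) − 1)/(q − 1)`. -/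
theorem card_WHv_subgroups (ℓ : ℕ) [Fact ℓ.Prime] (H : Type*) [Group H] [Finite H]
    (V : Type*) [AddCommGroup V] [Module (MonoidAlgebra (ZMod ℓ) H) V] [Finite V]
    [IsSimpleModule (MonoidAlgebra (ZMod ℓ) H) V]
    (hnontriv : ∃ (h : H) (v : V), (MonoidAlgebra.of (ZMod ℓ) H h) • v ≠ v)
    (q : ℕ) (hq : q = Nat.card (Module.End (MonoidAlgebra (ZMod ℓ) H) V))
    (r : ℕ) (hr : r = Module.finrank (Module.End (MonoidAlgebra (ZMod ℓ) H) V) V)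
    (φ : H →* MulAut (Multiplicative (Fin (r + 1) → V)))
    (hφ : ∀ (h : H) (a : Fin (r + 1) → V),
      (φ h (Multiplicative.ofAdd a)).toAdd = fun i => (MonoidAlgebra.of (ZMod ℓ) H h) • a i) :
    Nat.card {S : Subgroup (Multiplicative (Fin (r + 1) → V) ⋊[φ] H) |
        ∃ (W : Submodule (MonoidAlgebra (ZMod ℓ) H) (Fin (r + 1) → V)) (v : Fin (r + 1) → V),
          IsCoatom W ∧ S = mulWHv φ W.toAddSubgroup v} =
      q ^ r * ((q ^ (r + 1) - 1) / (q - 1)) := by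
  classical
  have hW (W : Submodule (MonoidAlgebra (ZMod ℓ) H) (Fin (r + 1) → V)) (h : H)
      (a : Fin (r + 1) → V) (ha : a ∈ W.toAddSubgroup) :
      (φ h (.ofAdd a)).toAdd ∈ W.toAddSubgroup := by
    rw [hφ]
    exact W.smul_mem _ ha
  have hmem (W : Submodule (MonoidAlgebra (ZMod ℓ) H) (Fin (r + 1) → V))
      (v a : Fin (r + 1) → V) (h : H) :
      ⟨.ofAdd a, h⟩ ∈ mulWHv φ W.toAddSubgroup v ↔
        a - (MonoidAlgebra.of (ZMod ℓ) H h • v - v) ∈ W := by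
    rw [SemidirectProduct.mem_mulWHv_iff φ _ (hW W), hφ]
    rfl
  have hquot (W : Submodule (MonoidAlgebra (ZMod ℓ) H) (Fin (r + 1) → V)) (hc : IsCoatom W) :
      Nat.card ((Fin (r + 1) → V) ⧸ W) = q ^ r := by
    obtain ⟨f, hf, rfl⟩ := Submodule.exists_ker_eq_of_isCoatom hc
    rw [Nat.card_congr
      (f.quotKerEquivOfSurjective (LinearMap.surjective_of_ne_zero hf)).toEquiv, hq, hr]
    have : Module.Finite (Module.End (MonoidAlgebra (ZMod ℓ) H) V) V := .of_finite
    exact Module.natCard_eq_pow_finrank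
  let Ψ : (Σ W : {W : Submodule (MonoidAlgebra (ZMod ℓ) H) (Fin (r + 1) → V) // IsCoatom W},
      (Fin (r + 1) → V) ⧸ W.1) → Subgroup (Multiplicative (Fin (r + 1) → V) ⋊[φ] H) :=
    fun p => mulWHv φ p.1.1.toAddSubgroup (Quotient.out p.2)
  have hΨ : Function.Injective Ψ := by
    rintro ⟨⟨W, hc⟩, x⟩ ⟨⟨W', hc'⟩, x'⟩ h
    have heq (a : Fin (r + 1) → V) (g : H) :=
      (hmem W x.out a g).symm.trans ((SetLike.ext_iff.mp h _).trans (hmem W' x'.out a g))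
    obtain rfl : W = W' := by
      ext a
      simpa only [map_one, one_smul, sub_self, sub_zero] using heq a 1
    obtain ⟨f, hf, hker⟩ := Submodule.exists_ker_eq_of_isCoatom hc
    have hfix : f (x.out - x'.out) = 0 := by
      refine MonoidAlgebra.eq_zero_of_forall_of_smul_eq hnontriv fun g => ?_
      have key := (heq (MonoidAlgebra.of (ZMod ℓ) H g • x.out - x.out) g).mp
        (by rw [sub_self]; exact W.zero_mem)
      replace key := hker.ge key
      rw [LinearMap.mem_ker] at key
      rw [← sub_eq_zero, ← key]
      simp only [map_sub, map_smul, smul_sub]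
      abel
    rw [← LinearMap.mem_ker, hker, ← Submodule.Quotient.eq] at hfix
    have hx : x = x' := by
      rw [← Quotient.out_eq x, ← Quotient.out_eq x']
      exact hfix
    rw [hx]
  have hrange : {S : Subgroup (Multiplicative (Fin (r + 1) → V) ⋊[φ] H) |
      ∃ (W : Submodule (MonoidAlgebra (ZMod ℓ) H) (Fin (r + 1) → V)) (v : Fin (r + 1) → V),
        IsCoatom W ∧ S = mulWHv φ W.toAddSubgroup v} = Set.range Ψ := by
    ext S
    constructor
    · rintro ⟨W, v, hc, rfl⟩
      refine ⟨⟨⟨W, hc⟩, Submodule.Quotient.mk v⟩, ?_⟩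
      have hd : (Submodule.Quotient.mk v : _ ⧸ W).out - v ∈ W :=
        (Submodule.Quotient.eq W).mp (Quotient.out_eq _)
      ext ⟨a, g⟩
      refine (hmem W _ a.toAdd g).trans (Iff.trans ?_ (hmem W v a.toAdd g).symm)
      rw [← Submodule.sub_mem_iff_left W
        (W.sub_mem hd (W.smul_mem (MonoidAlgebra.of (ZMod ℓ) H g) hd))]
      rw [smul_sub]
      convert Iff.rfl using 2
      abel
    · rintro ⟨⟨W, x⟩, rfl⟩
      exact ⟨W.1, x.out, W.2, rfl⟩
  have hcount := Submodule.card_isCoatom_pi_mul (R := MonoidAlgebra (ZMod ℓ) H) (V := V)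
    (ι := Fin (r + 1))
  rw [← hq, Fintype.card_fin] at hcount
  have hq1 : 0 < q - 1 := by
    have : Finite (Module.End (MonoidAlgebra (ZMod ℓ) H) V) :=
      .of_injective _ DFunLike.coe_injective
    have : 1 < q := hq ▸ Finite.one_lt_card
    lia
  have := Fintype.ofFinite
    {W : Submodule (MonoidAlgebra (ZMod ℓ) H) (Fin (r + 1) → V) // IsCoatom W}
  have (W : Submodule (MonoidAlgebra (ZMod ℓ) H) (Fin (r + 1) → V)) :
      Finite ((Fin (r + 1) → V) ⧸ W) := .of_surjective _ W.mkQ_surjective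
  rw [hrange, Nat.card_range_of_injective hΨ, ← hcount, Nat.mul_div_cancel _ hq1, Nat.card_sigma,
    Finset.sum_congr rfl fun W _ => hquot W.1 W.2]
  simp [mul_comm]
end

section
/- For every odd prime p there exists a group homomorphism φ from the quaternion group Q₈ of order 8 to GL₂(𝔽_p) such that: (i) φ is injective; (ii) the resulting action of Q₈ on the vector space (𝔽_p)² is irreducible, i.e. the only Q₈-invariant subspaces are 0 and the whole space; (iii) the action is absolutely irreducible, i.e. every 2×2 matrix over 𝔽_p commuting with φ(g) for all g ∈ Q₈ is a scalar matrix (so the endomorphism ring of the module is 𝔽_p); and (iv) the action is fixed-point-free, i.e. for every non-identity g ∈ Q₈, the only vector v ∈ (𝔽_p)² with φ(g)·v = v is v = 0. -/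
namespace QuaternionGroup

variable {n : ℕ} {G : Type*} [Group G]

/-- A homomorphism out of `QuaternionGroup n`, built from a homomorphism `f` on its cyclic subgroup
and an image `x` of `xa 0` which squares to the image of `a n` and inverts the range of `f`. -/
def lift (f : Multiplicative (ZMod (2 * n)) →* G) (x : G)
    (hx : x * x = f (Multiplicative.ofAdd (n : ZMod (2 * n))))
    (hinv : ∀ i, f i * x = x * (f i)⁻¹) : QuaternionGroup n →* G :=
  MonoidHom.mk'
    (fun g => match g with
      | a i => f (Multiplicative.ofAdd i)
      | xa i => x * f (Multiplicative.ofAdd i))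
    (by
      have hcomm (i j) : f i * f j = f j * f i := by
        rw [← map_mul f, mul_comm i j, map_mul f]
      rintro (i | i) (j | j)
      · simp [ofAdd_add]
      · simp only [a_mul_xa, ofAdd_sub, map_div f]
        rw [← mul_assoc, hinv, mul_assoc, ← map_inv f, hcomm, map_inv f, div_eq_mul_inv]
      · simp [ofAdd_add, mul_assoc]
      · simp only [xa_mul_xa, ofAdd_sub, ofAdd_add, map_div f, map_mul f, ← hx]
        rw [mul_assoc x (f _), ← mul_assoc (f _) x, hinv, mul_assoc x (f _)⁻¹, ← map_inv f, hcomm,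
          map_inv f, div_eq_mul_inv]
        simp only [mul_assoc])

@[simp]
theorem lift_a (f : Multiplicative (ZMod (2 * n)) →* G) (x : G) (hx hinv) (i : ZMod (2 * n)) :
    lift f x hx hinv (a i) = f (Multiplicative.ofAdd i) := rfl

@[simp]
theorem lift_xa (f : Multiplicative (ZMod (2 * n)) →* G) (x : G) (hx hinv) (i : ZMod (2 * n)) :
    lift f x hx hinv (xa i) = x * f (Multiplicative.ofAdd i) := rfl

/-- Elements `y`, `x` of a group satisfying the defining relations of `QuaternionGroup n` are the
images of its generators under a homomorphism. -/
theorem exists_monoidHom (y x : G) (hy : y ^ (2 * n) = 1) (hx : x * x = y ^ n)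
    (hyx : y * x = x * y⁻¹) :
    ∃ φ : QuaternionGroup n →* G, φ (a 1) = y ∧ φ (xa 0) = x := by
  let F : ZMod (2 * n) →+ Additive G :=
    ZMod.lift (2 * n) ⟨zmultiplesHom (Additive G) (Additive.ofMul y), by
      rw [zmultiplesHom_apply, ← ofMul_zpow, zpow_natCast, hy, ofMul_one]⟩
  let f : Multiplicative (ZMod (2 * n)) →* G := AddMonoidHom.toMultiplicativeLeft F
  have hf (k : ℤ) : f (Multiplicative.ofAdd (k : ZMod (2 * n))) = y ^ k := by
    simp [f, F, ZMod.lift_coe]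
  refine ⟨lift f x ?_ fun i => ?_, ?_, ?_⟩
  · simpa [hx] using (hf n).symm
  · obtain ⟨k, hk⟩ := ZMod.intCast_surjective i.toAdd
    obtain rfl : i = Multiplicative.ofAdd (k : ZMod (2 * n)) := by rw [hk, ofAdd_toAdd]
    rw [hf, ← inv_zpow]
    have h : SemiconjBy x y⁻¹ y := hyx.symm
    exact (h.zpow_right k).symm
  · simpa using hf 1
  · simp

theorem eq_or_sq_eq_a_two (g : QuaternionGroup 2) (hg : g ≠ 1) : g = a 2 ∨ g * g = a 2 := by
  revert g; decide

end QuaternionGroup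

open Matrix

section

variable {F : Type*} [Field F] {s t : F}

/-- A subspace of the plane stable under `!![0, -1; 1, 0]` and `!![s, t; t, -s]`, where
`s ^ 2 + t ^ 2 = -1`, is trivial in odd characteristic. -/
theorem Submodule.eq_bot_or_eq_top_of_mulVec_mem (h2 : (2 : F) ≠ 0) (hst : s ^ 2 + t ^ 2 = -1)
    (U : Submodule F (Fin 2 → F)) (hI : ∀ v ∈ U, !![0, -1; 1, 0] *ᵥ v ∈ U)
    (hJ : ∀ v ∈ U, !![s, t; t, -s] *ᵥ v ∈ U) : U = ⊥ ∨ U = ⊤ := by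
  have htop (v) (hv : v ∈ U) (h0 : v 0 ≠ 0) : U = ⊤ := by
    have hK := hI _ (hJ v hv)
    have he : ![1, 0] ∈ U := by
      have h := U.smul_mem (2 * v 0)⁻¹
        (U.sub_mem hv (U.sub_mem (U.smul_mem s (hJ v hv)) (U.smul_mem t hK)))
      convert h using 1
      ext i
      fin_cases i
      · simp [mulVec_eq_sum, Fin.sum_univ_two]
        field_simp
        linear_combination (v 0) * hst
      · simp [mulVec_eq_sum, Fin.sum_univ_two]
        right
        linear_combination (v 1) * hst
    refine eq_top_iff.2 fun w _ => ?_
    convert U.add_mem (U.smul_mem (w 0) he) (U.smul_mem (w 1) (hI _ he)) using 1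
    ext i
    fin_cases i <;> simp
  refine or_iff_not_imp_left.2 fun hU => ?_
  obtain ⟨v, hv, hv0⟩ := U.exists_mem_ne_zero_of_ne_bot hU
  by_cases h0 : v 0 = 0
  · refine htop _ (hI v hv) fun h1 => hv0 ?_
    ext i
    fin_cases i
    · exact h0
    · simpa [mulVec, dotProduct, Fin.sum_univ_two] using h1
  · exact htop v hv h0

/-- A matrix commuting with `!![0, -1; 1, 0]` and `!![s, t; t, -s]`, where `s ^ 2 + t ^ 2 = -1`,
is scalar in odd characteristic. -/
theorem Matrix.eq_smul_one_of_commute (h2 : (2 : F) ≠ 0) (hst : s ^ 2 + t ^ 2 = -1)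
    (m : Matrix (Fin 2) (Fin 2) F) (hI : m * !![0, -1; 1, 0] = !![0, -1; 1, 0] * m)
    (hJ : m * !![s, t; t, -s] = !![s, t; t, -s] * m) : m = m 0 0 • (1 : Matrix _ _ F) := by
  have h00 := congr_fun₂ hI 0 0
  have h01 := congr_fun₂ hI 0 1
  have k00 := congr_fun₂ hJ 0 0
  have k01 := congr_fun₂ hJ 0 1
  simp [mul_apply, Fin.sum_univ_two] at h00 h01 k00 k01
  have hm : m 1 0 = 0 := by
    refine (mul_eq_zero_iff_left h2).1 ?_
    grind
  ext i j
  fin_cases i <;> fin_cases j <;> simp <;> grind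

end


/-- For every odd prime `p` there is a group homomorphism `φ` from the quaternion
group `Q₈` (realized as `QuaternionGroup 2`, of order 8) to `GL₂(𝔽_p)` which is:
(i) injective; (ii) irreducible: the only `Q₈`-invariant subspaces of `(𝔽_p)²` are
`⊥` and `⊤`; (iii) absolutely irreducible: every `2×2` matrix over `𝔽_p` commuting
with all `φ(g)` is scalar; and (iv) fixed-point-free: for every `g ≠ 1`, the only
vector fixed by `φ(g)` is `0`. -/
theorem quaternion_faithful_absolutely_irreducible_fpf_rep
    (p : ℕ) (hp : p.Prime) (hodd : Odd p) :
    ∃ φ : QuaternionGroup 2 →* GL (Fin 2) (ZMod p),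
      Function.Injective φ ∧
      (∀ U : Submodule (ZMod p) (Fin 2 → ZMod p),
        (∀ (g : QuaternionGroup 2), ∀ v ∈ U,
          (φ g : Matrix (Fin 2) (Fin 2) (ZMod p)).mulVec v ∈ U) →
        U = ⊥ ∨ U = ⊤) ∧
      (∀ m : Matrix (Fin 2) (Fin 2) (ZMod p),
        (∀ g : QuaternionGroup 2,
          m * (φ g : Matrix (Fin 2) (Fin 2) (ZMod p)) =
            (φ g : Matrix (Fin 2) (Fin 2) (ZMod p)) * m) →
        ∃ c : ZMod p, m = c • (1 : Matrix (Fin 2) (Fin 2) (ZMod p))) ∧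
      (∀ g : QuaternionGroup 2, g ≠ 1 → ∀ v : Fin 2 → ZMod p,
        (φ g : Matrix (Fin 2) (Fin 2) (ZMod p)).mulVec v = v → v = 0) := by
  have : Fact p.Prime := ⟨hp⟩
  have h2 : (2 : ZMod p) ≠ 0 := by
    intro h
    have hdvd : p ∣ 2 := (ZMod.natCast_eq_zero_iff 2 p).1 (by exact_mod_cast h)
    rw [(Nat.prime_dvd_prime_iff_eq hp Nat.prime_two).1 hdvd] at hodd
    exact absurd hodd (by decide)
  obtain ⟨s, t, hst⟩ := ZMod.sq_add_sq p (-1)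
  let I : GL (Fin 2) (ZMod p) :=
    GeneralLinearGroup.mkOfDetNeZero !![0, -1; 1, 0] (by simp [det_fin_two])
  let J : GL (Fin 2) (ZMod p) := GeneralLinearGroup.mkOfDetNeZero !![s, t; t, -s] (by
    have h : -(s * s) - t * t = 1 := by linear_combination -hst
    simp [det_fin_two, h])
  have hI : (I : Matrix (Fin 2) (Fin 2) (ZMod p)) = !![0, -1; 1, 0] := rfl
  have hJ : (J : Matrix (Fin 2) (Fin 2) (ZMod p)) = !![s, t; t, -s] := rfl
  have hII : I * I = -1 := by
    ext i j
    fin_cases i <;> fin_cases j <;> simp [hI]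
  have hJJ : J * J = -1 := by
    ext i j
    fin_cases i <;> fin_cases j <;> simp [hJ] <;> grind
  have hIJI : I * J * I = J := by
    ext i j
    fin_cases i <;> fin_cases j <;> simp [hI, hJ]
  obtain ⟨φ, hφI, hφJ⟩ := QuaternionGroup.exists_monoidHom (n := 2) I J
    (by rw [pow_mul, pow_two I, hII, neg_one_sq]) (by rw [hJJ, pow_two, hII])
    (eq_mul_inv_of_mul_eq hIJI)
  have hneg : φ (.a 2) = -1 := by
    rw [← hII, ← hφI, ← map_mul]
    rfl
  have hfix (g : QuaternionGroup 2) (hg : g ≠ 1) (v : Fin 2 → ZMod p)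
      (hv : (φ g : Matrix (Fin 2) (Fin 2) (ZMod p)).mulVec v = v) : v = 0 := by
    have hv2 : (φ (.a 2) : Matrix (Fin 2) (Fin 2) (ZMod p)).mulVec v = v := by
      rcases QuaternionGroup.eq_or_sq_eq_a_two g hg with rfl | h
      · exact hv
      · rw [← h, map_mul, Units.val_mul, ← mulVec_mulVec, hv, hv]
    rw [hneg, Units.val_neg, Units.val_one, neg_mulVec, one_mulVec] at hv2
    have h : (2 : ZMod p) • v = 0 := by rw [two_smul]; nth_rw 1 [← hv2]; simp
    exact (smul_eq_zero.1 h).resolve_left h2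
  refine ⟨φ, (injective_iff_map_eq_one φ).2 fun g hg => ?_, fun U hU => ?_, fun m hm => ?_, hfix⟩
  · by_contra hne
    simpa using congr_fun (hfix g hne ![1, 0] (by rw [hg, Units.val_one, one_mulVec])) 0
  · exact U.eq_bot_or_eq_top_of_mulVec_mem h2 hst (fun v hv => by simpa only [hφI] using! hU (.a 1) v hv)
      fun v hv => by simpa only [hφJ] using! hU (.xa 0) v hv
  · refine ⟨m 0 0, eq_smul_one_of_commute h2 hst m ?_ ?_⟩
    · simpa only [hφI] using! hm (.a 1)
    · simpa only [hφJ] using! hm (.xa 0)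
end

section
/- Let q be a prime power, let p be an odd prime dividing q + 1, let F be a finite field with q elements and E a field extension of F with q² elements. Then there exists an injective group homomorphism φ from the dihedral group D_p of order 2p into the group of invertible F-linear maps of E such that: (i) a generator a of the rotation subgroup of order p acts as multiplication by an element ζ ∈ E of multiplicative order p (such ζ exists since p divides q+1, which divides q²−1), and a reflection b acts as the Frobenius map x ↦ x^q; (ii) the resulting F[D_p]-module E is irreducible; (iii) every F-linear endomorphism of E commuting with the action of D_p is multiplication by an element of F, so End_{F[D_p]}(E) ≅ F; (iv) every element of D_p of order p has no nonzero fixed vector in E; and (v) the fixed-point subspace of the reflection b is the subfield F, of cardinality q. -/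
/-- An additive character `χ` of `ZMod n` with values in an algebra `A` and an involution `σ` of
`A` that inverts the values of `χ` define a representation of the dihedral group on `A`: rotations
act by multiplication by the values of `χ` and the reflection `sr 0` acts as `σ`. -/
def DihedralGroup.semilinearRep {n : ℕ} {R A : Type*} [CommSemiring R] [CommSemiring A]
    [Algebra R A] (χ : AddChar (ZMod n) A) (σ : A →ₐ[R] A) (hσ : ∀ x, σ (σ x) = x)
    (hχ : ∀ i, σ (χ i) = χ (-i)) : DihedralGroup n →* Module.End R A where
  toFun
    | .r i => LinearMap.mulLeft R (χ i)
    | .sr i => σ.toLinearMap ∘ₗ LinearMap.mulLeft R (χ i)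
  map_one' := by
    rw [DihedralGroup.one_def]
    ext x
    simp
  map_mul' := by
    rintro (i | i) (j | j) <;> ext x <;>
      simp [hσ, hχ, sub_eq_neg_add, AddChar.map_add_eq_mul, mul_left_comm]

section FieldExtension

variable {F E : Type*} [Field F] [Field E] [Algebra F E]

theorem FiniteField.pow_card_eq_self_iff_mem_range_algebraMap [Fintype F] [Finite E] (x : E) :
    x ^ Fintype.card F = x ↔ x ∈ Set.range (algebraMap F E) := by
  constructor
  · intro hx
    rw [IsGalois.mem_range_algebraMap_iff_fixed]
    intro g
    obtain ⟨n, rfl⟩ := (FiniteField.bijective_frobeniusAlgEquivOfAlgebraic_pow F E).2 g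
    have hfix : Function.IsFixedPt (FiniteField.frobeniusAlgEquivOfAlgebraic F E) x := hx
    simpa [AlgEquiv.coe_pow] using! hfix.iterate n.1
  · rintro ⟨c, rfl⟩
    rw [← map_pow, FiniteField.pow_card]

theorem Algebra.adjoin_singleton_eq_top_of_finrank_prime (h : (Module.finrank F E).Prime) {ζ : E}
    (hζ : ζ ∉ Set.range (algebraMap F E)) : Algebra.adjoin F {ζ} = ⊤ := by
  have := Subalgebra.isSimpleOrder_of_finrank_prime F E h
  refine (eq_bot_or_eq_top _).resolve_left fun hbot ↦ hζ ?_
  rw [← Algebra.mem_bot, ← hbot]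
  exact Algebra.self_mem_adjoin_singleton F ζ

theorem Submodule.eq_bot_or_eq_top_of_mul_mem {ζ : E} (hζ : Algebra.adjoin F {ζ} = ⊤)
    (U : Submodule F E) (hU : ∀ x ∈ U, ζ * x ∈ U) : U = ⊥ ∨ U = ⊤ := by
  have hmul (c : E) : ∀ x ∈ U, c * x ∈ U := by
    have hc : c ∈ Algebra.adjoin F {ζ} := hζ ▸ Algebra.mem_top
    induction hc using Algebra.adjoin_induction with
    | mem y hy => rwa [Set.mem_singleton_iff.mp hy]
    | algebraMap r => exact fun x hx ↦ by simpa [Algebra.smul_def] using U.smul_mem r hx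
    | add y z _ _ hy hz => exact fun x hx ↦ by simpa [add_mul] using U.add_mem (hy x hx) (hz x hx)
    | mul y z _ _ hy hz => exact fun x hx ↦ by simpa [mul_assoc] using hy _ (hz x hx)
  refine or_iff_not_imp_left.mpr fun hbot ↦ eq_top_iff.mpr fun x _ ↦ ?_
  obtain ⟨u, hu, hu0⟩ := U.exists_mem_ne_zero_of_ne_bot hbot
  simpa [hu0] using hmul (x * u⁻¹) u hu

theorem LinearMap.map_mul_of_adjoin_singleton_eq_top {ζ : E} (hζ : Algebra.adjoin F {ζ} = ⊤)
    (f : E →ₗ[F] E) (hf : ∀ x, f (ζ * x) = ζ * f x) (c x : E) : f (c * x) = c * f x := by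
  have hc : c ∈ Algebra.adjoin F {ζ} := hζ ▸ Algebra.mem_top
  induction hc using Algebra.adjoin_induction generalizing x with
  | mem y hy => rw [Set.mem_singleton_iff.mp hy, hf]
  | algebraMap r => rw [← Algebra.smul_def, map_smul, Algebra.smul_def]
  | add y z _ _ hy hz => rw [add_mul, map_add, hy, hz, add_mul]
  | mul y z _ _ hy hz => rw [mul_assoc, hy, hz, mul_assoc]

end FieldExtension

/-- Let `q` be a prime power, `p` an odd prime dividing `q + 1`, `F` a field with
`q` elements and `E` an extension of `F` with `q²` elements.  Then there is an
injective homomorphism `φ` from the dihedral group `D_p` of order `2p` into the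
group of invertible `F`-linear maps of `E` such that: (i) the rotation `a` acts as
multiplication by an element `ζ` of multiplicative order `p` and the reflection `b`
acts as the Frobenius `x ↦ x^q`; (ii) the `F[D_p]`-module `E` is irreducible;
(iii) every `F`-linear endomorphism of `E` commuting with the action is
multiplication by an element of `F`; (iv) every element of order `p` has no nonzero
fixed vector; and (v) the fixed points of the reflection `b` form the subfield `F`. -/
theorem dihedral_faithful_irreducible_rep
    (q p : ℕ) (hq : ∃ ℓ k : ℕ, ℓ.Prime ∧ 1 ≤ k ∧ q = ℓ ^ k)
    (hp : p.Prime) (hodd : Odd p) (hdvd : p ∣ q + 1)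
    (F : Type*) [Field F] [Fintype F] (hF : Fintype.card F = q)
    (E : Type*) [Field E] [Algebra F E] [Fintype E] (hE : Fintype.card E = q ^ 2) :
    ∃ φ : DihedralGroup p →* LinearMap.GeneralLinearGroup F E,
      Function.Injective φ ∧
      (∃ ζ : E, orderOf ζ = p ∧
        ∀ x : E, (φ (DihedralGroup.r 1) : E →ₗ[F] E) x = ζ * x) ∧
      (∀ x : E, (φ (DihedralGroup.sr 0) : E →ₗ[F] E) x = x ^ q) ∧
      (∀ U : Submodule F E,
        (∀ g : DihedralGroup p, ∀ x ∈ U, (φ g : E →ₗ[F] E) x ∈ U) → U = ⊥ ∨ U = ⊤) ∧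
      (∀ f : E →ₗ[F] E,
        (∀ (g : DihedralGroup p) (x : E), f ((φ g : E →ₗ[F] E) x) = (φ g : E →ₗ[F] E) (f x)) →
        ∃ c : F, ∀ x : E, f x = algebraMap F E c * x) ∧
      (∀ g : DihedralGroup p, orderOf g = p →
        ∀ x : E, (φ g : E →ₗ[F] E) x = x → x = 0) ∧
      (∀ x : E, (φ (DihedralGroup.sr 0) : E →ₗ[F] E) x = x ↔ x ∈ Set.range (algebraMap F E)) := by
  classical
  subst hF
  have : Fact p.Prime := ⟨hp⟩
  have hrank : Module.finrank F E = 2 :=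
    Nat.pow_right_injective Fintype.one_lt_card (Module.card_eq_pow_finrank.symm.trans hE)
  obtain ⟨u, hu⟩ : ∃ u : Eˣ, orderOf u = p := by
    refine exists_prime_orderOf_dvd_card p ?_
    rw [Fintype.card_units, hE, ← one_pow 2, Nat.sq_sub_sq]
    exact hdvd.mul_right _
  set ζ : E := (u : E) with hζ
  have hord : orderOf ζ = p := by rw [hζ, orderOf_units, hu]
  have hpow : ζ ^ p = 1 := hord ▸ pow_orderOf_eq_one ζ
  set χ := AddChar.zmodChar p hpow
  have hχ1 : χ 1 = ζ := by simpa using AddChar.zmodChar_apply' hpow 1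
  have hχ0 (i : ZMod p) (hi : χ i = 1) : i = 0 := by
    have hval : p ∣ i.val := hord.symm.dvd.trans (orderOf_dvd_of_pow_eq_one hi)
    exact (ZMod.val_eq_zero i).mp (Nat.eq_zero_of_dvd_of_lt hval i.val_lt)
  have hχinv (i : ZMod p) : χ i ^ Fintype.card F = χ (-i) := by
    have hcast : ((Fintype.card F : ℕ) : ZMod p) + 1 = 0 := by
      exact_mod_cast (ZMod.natCast_eq_zero_iff _ _).mpr hdvd
    rw [← AddChar.map_nsmul_eq_pow, nsmul_eq_mul, eq_neg_of_add_eq_zero_left hcast, neg_one_mul]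
  have hχfix (i : ZMod p) (hi : χ i ^ Fintype.card F = χ i) : i = 0 := by
    rw [hχinv] at hi
    have hi2 : χ (i + i) = 1 := by
      rw [AddChar.map_add_eq_mul]
      nth_rw 1 [← hi]
      rw [← AddChar.map_add_eq_mul, neg_add_cancel, AddChar.map_zero_eq_one]
    exact (ZMod.add_self_eq_zero_iff_eq_zero hodd).mp (hχ0 _ hi2)
  have hadjoin : Algebra.adjoin F {ζ} = ⊤ := by
    refine Algebra.adjoin_singleton_eq_top_of_finrank_prime (hrank ▸ Nat.prime_two) fun h ↦ ?_
    rw [← FiniteField.pow_card_eq_self_iff_mem_range_algebraMap, ← hχ1] at h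
    exact one_ne_zero (hχfix 1 h)
  let ρ := DihedralGroup.semilinearRep χ (FiniteField.frobeniusAlgHom F E)
    (fun x ↦ by simp [← pow_mul, ← sq, ← hE, FiniteField.pow_card]) hχinv
  have hr (i : ZMod p) (x : E) : ρ (.r i) x = χ i * x := rfl
  have hsr (i : ZMod p) (x : E) : ρ (.sr i) x = (χ i * x) ^ Fintype.card F := rfl
  have hfrob (x : E) : ρ (.sr 0) x = x ^ Fintype.card F := by
    rw [hsr, AddChar.map_zero_eq_one, one_mul]
  refine ⟨ρ.toHomUnits, ?_, ⟨ζ, hord, fun x ↦ by simp [hr, hχ1]⟩, hfrob, fun U hU ↦ ?_,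
    fun f hf ↦ ?_, ?_, fun x ↦ ?_⟩
  · rw [injective_iff_map_eq_one]
    intro g hg
    have hρ (x : E) : ρ g x = x := LinearMap.congr_fun (congrArg Units.val hg) x
    rcases g with i | i
    · have hi := hρ 1
      rw [hr, mul_one] at hi
      rw [hχ0 i hi, DihedralGroup.r_zero]
    · have hi := hρ 1
      rw [hsr, mul_one, hχinv] at hi
      have hx := hρ ζ
      rw [neg_eq_zero.mp (hχ0 _ hi), hfrob, ← hχ1] at hx
      exact absurd (hχfix 1 hx) one_ne_zero
  · exact U.eq_bot_or_eq_top_of_mul_mem hadjoin fun x hx ↦ hχ1 ▸ hU (.r 1) x hx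
  · have hmul := f.map_mul_of_adjoin_singleton_eq_top hadjoin fun x ↦ hχ1 ▸ hf (.r 1) x
    have hone : f 1 ^ Fintype.card F = f 1 := by
      have h := hf (.sr 0) 1
      simp only [MonoidHom.coe_toHomUnits, hfrob, one_pow] at h
      exact h.symm
    obtain ⟨c, hc⟩ := (FiniteField.pow_card_eq_self_iff_mem_range_algebraMap _).mp hone
    exact ⟨c, fun x ↦ by simpa [hc, mul_comm] using hmul x 1⟩
  · rintro (i | i) hg x hx
    · have hi : χ i ≠ 1 := fun h ↦ hp.one_lt.ne <| by
        rw [← hg, hχ0 i h, DihedralGroup.r_zero, orderOf_one]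
      by_contra hx0
      exact hi ((mul_eq_right₀ hx0).mp hx)
    · rw [DihedralGroup.orderOf_sr] at hg
      exact absurd (hg ▸ hodd) (by decide)
  · rw [← FiniteField.pow_card_eq_self_iff_mem_range_algebraMap, ← hfrob]
    rfl
end
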